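/- Let p ≥ -1 be a real number and let Ω ⊂ ℝ² be a bounded open connected set with C² boundary such that 0 ∈ Ω. If equality holds in the inequality (|Ω|/π)^((p+1)/2) ≤ (1/(2π)) ∫_{∂Ω} |x|^p dσ(x), then Ω is an open disc; moreover, if p ≠ 0, then this disc is centered at the origin. -/

import Mathlib

open MeasureTheory Metric Real

/-- `Ω ⊂ ℝ²` has `C²` boundary: its topological boundary is a finite union of
images of periodic regular `C²` closed curves. -/
def HasC2Boundary (Ω : Set (EuclideanSpace ℝ (Fin 2))) : Prop :=
  ∃ (n : ℕ) (γ : Fin n → ℝ → EuclideanSpace ℝ (Fin 2)),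
    (∀ i, ContDiff ℝ 2 (γ i)) ∧ (∀ i, Function.Periodic (γ i) 1) ∧
    (∀ i t, deriv (γ i) t ≠ 0) ∧ frontier Ω = ⋃ i, Set.range (γ i)

lemma wi_antilip {F : Type*} [NormedAddCommGroup F] [NormedSpace ℝ F] (c : ℝ → F)
    (hc : Differentiable ℝ c) (I : Set ℝ) (hI : Convex ℝ I) (v : F) (ε : ℝ)
    (h : ∀ t ∈ I, ‖deriv c t - v‖ ≤ ε * ‖v‖) :
    ∀ s ∈ I, ∀ t ∈ I, (1 - ε) * ‖v‖ * |s - t| ≤ ‖c s - c t‖ := by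
  intro s hs t ht
  have h1 := Convex.norm_image_sub_le_of_norm_hasDerivWithin_le (f := fun t => c t - t • v)
    (f' := fun t => deriv c t - v) (C := ε * ‖v‖) (s := I) (x := t) (y := s) ?_ h hI ht hs
  · have h2 : (s - t) • v = (c s - c t) - ((c s - s • v) - (c t - t • v)) := by
      rw [sub_smul]; abel
    have h3 : ‖(s - t) • v‖ ≤ ‖c s - c t‖ + ε * ‖v‖ * ‖s - t‖ := by
      rw [h2]; exact (norm_sub_le _ _).trans (by gcongr)
    rw [norm_smul, Real.norm_eq_abs] at h3
    nlinarith
  · intro x hx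
    have := ((hc x).hasDerivAt.sub ((hasDerivAt_id x).smul_const v)).hasDerivWithinAt (s := I)
    rw [one_smul] at this
    exact this

lemma wi_unif {F : Type*} [NormedAddCommGroup F] [NormedSpace ℝ F] (c : ℝ → F)
    (hc : ContDiff ℝ 1 c) (hreg : ∀ t, deriv c t ≠ 0) (a b : ℝ) (hab : a ≤ b)
    (ε : ℝ) (hε : 0 < ε) :
    ∃ N : ℕ, 0 < N ∧ ∀ s ∈ Set.Icc a b, ∀ t ∈ Set.Icc a b, |s - t| ≤ 1 / N →
      ‖deriv c t - deriv c s‖ ≤ ε * ‖deriv c s‖ := by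
  have hcont : Continuous (deriv c) := hc.continuous_deriv le_rfl
  obtain ⟨t0, ht0, hmin⟩ := (isCompact_Icc (a := a) (b := b)).exists_isMinOn
    ⟨a, by simp [hab]⟩ hcont.norm.continuousOn
  have hm : 0 < ‖deriv c t0‖ := norm_pos_iff.2 (hreg t0)
  have hu := (isCompact_Icc (a := a) (b := b)).uniformContinuousOn_of_continuous
    hcont.continuousOn
  rw [Metric.uniformContinuousOn_iff_le] at hu
  obtain ⟨δ, hδ, hd⟩ := hu (ε * ‖deriv c t0‖) (by positivity)
  obtain ⟨N, hN⟩ := exists_nat_one_div_lt hδ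
  refine ⟨N + 1, by omega, fun s hs t ht hst => ?_⟩
  have h1 := hd t ht s hs (by
    rw [Real.dist_eq, abs_sub_comm]; push_cast at hst; linarith)
  rw [dist_eq_norm] at h1
  refine h1.trans ?_
  have := isMinOn_iff.1 hmin s hs
  gcongr

lemma wi_haus_antilip {F : Type*} [NormedAddCommGroup F] [NormedSpace ℝ F]
    [MeasurableSpace F] [BorelSpace F] (c : ℝ → F)
    (S : Set ℝ) (l : ℝ) (hl : 0 < l) (h : ∀ s ∈ S, ∀ t ∈ S, l * |s - t| ≤ ‖c s - c t‖) :
    ENNReal.ofReal l * volume S ≤ μH[1] (c '' S) := by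
  have hinj : Set.InjOn c S := by
    intro s hs t ht hst
    have := h s hs t ht
    rw [hst, sub_self, norm_zero] at this
    have h2 : |s - t| ≤ 0 := by
      by_contra! h3
      nlinarith [mul_pos hl h3]
    exact sub_eq_zero.1 (abs_nonpos_iff.1 h2)
  have hlip : LipschitzOnWith (Real.toNNReal l⁻¹) (Function.invFunOn c S) (c '' S) := by
    apply LipschitzOnWith.of_dist_le_mul
    rintro _ ⟨s, hs, rfl⟩ _ ⟨t, ht, rfl⟩
    rw [hinj.leftInvOn_invFunOn hs, hinj.leftInvOn_invFunOn ht, Real.coe_toNNReal _ (by positivity),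
      Real.dist_eq, dist_eq_norm]
    have := h s hs t ht
    rw [← div_eq_inv_mul, le_div_iff₀ hl]; linarith
  have h1 := hlip.hausdorffMeasure_image_le (d := 1) zero_le_one
  rw [hinj.leftInvOn_invFunOn.image_image, hausdorffMeasure_real] at h1
  simp only [ENNReal.rpow_one] at h1
  calc ENNReal.ofReal l * volume S ≤ ENNReal.ofReal l * (Real.toNNReal l⁻¹ * μH[1] (c '' S)) := by
        gcongr
    _ = μH[1] (c '' S) := by
        rw [← mul_assoc]
        have : ENNReal.ofReal l * (Real.toNNReal l⁻¹ : ENNReal) = 1 := by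
          change ENNReal.ofReal l * ENNReal.ofReal l⁻¹ = 1
          rw [← ENNReal.ofReal_mul hl.le, mul_inv_cancel₀ hl.ne', ENNReal.ofReal_one]
        rw [this, one_mul]

lemma wi_arc_le {F : Type*} [NormedAddCommGroup F] [NormedSpace ℝ F]
    [MeasurableSpace F] [BorelSpace F] (c : ℝ → F)
    (hc : ContDiff ℝ 1 c) (hreg : ∀ t, deriv c t ≠ 0) (S : Set ℝ) (hS : MeasurableSet S)
    (a b : ℝ) (hab : a ≤ b) (hS1 : S ⊆ Set.Icc a b) (hinj : Set.InjOn c S) :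
    ∫⁻ t in S, ENNReal.ofReal ‖deriv c t‖ ≤ μH[1] (c '' S) := by
  have key : ∀ ε : ℝ, 0 < ε → ε < 1 →
      ENNReal.ofReal ((1 - ε) / (1 + ε)) * ∫⁻ t in S, ENNReal.ofReal ‖deriv c t‖
        ≤ μH[1] (c '' S) := by
    intro ε hε hε1
    obtain ⟨N, hN, hun⟩ := wi_unif c hc hreg a b hab ε hε
    have hN' : (0:ℝ) < N := by exact_mod_cast hN
    let I : ℤ → Set ℝ := fun j => S ∩ {t | ⌊t * N⌋ = j}
    have hIm : ∀ j, MeasurableSet (I j) := fun j =>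
      hS.inter ((Int.measurable_floor.comp (measurable_id.mul_const _)) (measurableSet_singleton j))
    have hId : Pairwise (Function.onFun Disjoint I) := by
      intro i j hij
      refine Set.disjoint_left.2 fun t h1 h2 => hij (h1.2.symm.trans h2.2)
    have hIU : S = ⋃ j, I j := by
      ext t; simp [I]
    have hpiece : ∀ j, ENNReal.ofReal ((1 - ε) / (1 + ε)) *
        ∫⁻ t in I j, ENNReal.ofReal ‖deriv c t‖ ≤ μH[1] (c '' I j) := by
      intro j
      rcases (I j).eq_empty_or_nonempty with h0 | ⟨t0, ht0⟩
      · rw [h0]; simp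
      have hclose : ∀ t ∈ Set.Icc (j / N : ℝ) ((j + 1) / N) ∩ Set.Icc a b,
          ‖deriv c t - deriv c t0‖ ≤ ε * ‖deriv c t0‖ := by
        intro t ht
        refine hun t0 (hS1 ht0.1) t ht.2 ?_
        have h1 := Int.floor_eq_iff.1 ht0.2
        have h2 := ht.1
        rw [Set.mem_Icc, div_le_iff₀ hN', le_div_iff₀ hN'] at h2
        have h9 : |t0 - t| * N = |(t0 - t) * N| := by rw [abs_mul, abs_of_pos hN']
        rw [le_div_iff₀ hN', h9, abs_le]
        constructor <;> nlinarith
      have hsub : I j ⊆ Set.Icc (j / N : ℝ) ((j + 1) / N) ∩ Set.Icc a b := by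
        intro t ht
        refine ⟨?_, hS1 ht.1⟩
        have h1 := Int.floor_eq_iff.1 ht.2
        rw [Set.mem_Icc, div_le_iff₀ hN', le_div_iff₀ hN']
        exact ⟨h1.1, h1.2.le⟩
      have hv : 0 < ‖deriv c t0‖ := norm_pos_iff.2 (hreg t0)
      have hal := wi_antilip c (hc.differentiable one_ne_zero) _
        ((convex_Icc _ _).inter (convex_Icc _ _)) _ ε hclose
      have h3 := wi_haus_antilip c (I j) ((1 - ε) * ‖deriv c t0‖) (by nlinarith)
        (fun s hs t ht => hal s (hsub hs) t (hsub ht))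
      refine le_trans ?_ h3
      have h4 : ∫⁻ t in I j, ENNReal.ofReal ‖deriv c t‖ ≤
          ENNReal.ofReal ((1 + ε) * ‖deriv c t0‖) * volume (I j) := by
        rw [← setLIntegral_const]
        refine setLIntegral_mono measurable_const fun t ht => ENNReal.ofReal_le_ofReal ?_
        have := hclose t (hsub ht)
        have h5 := norm_sub_norm_le (deriv c t) (deriv c t0)
        linarith
      calc _ ≤ ENNReal.ofReal ((1 - ε) / (1 + ε)) *
            (ENNReal.ofReal ((1 + ε) * ‖deriv c t0‖) * volume (I j)) := by gcongr
        _ = _ := by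
          rw [← mul_assoc, ← ENNReal.ofReal_mul (div_nonneg (by linarith) (by linarith))]
          congr 2
          field_simp
    have hU : c '' S = ⋃ j, c '' I j := by rw [← Set.image_iUnion, ← hIU]
    rw [hU, measure_iUnion]
    · conv_lhs => rw [hIU]
      rw [lintegral_iUnion hIm hId, ← ENNReal.tsum_mul_left]
      exact ENNReal.tsum_le_tsum hpiece
    · intro i j hij
      exact Set.disjoint_image_image (fun s hs t ht hst =>
        (Set.disjoint_left.1 (hId hij) hs) (by
          have := hinj hs.1 ht.1 hst
          rw [this]; exact ht))
    · intro j
      exact (hIm j).image_of_continuousOn_injOn hc.continuous.continuousOn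
        (hinj.mono Set.inter_subset_left)
  have hlim : Filter.Tendsto (fun ε : ℝ => ENNReal.ofReal ((1 - ε) / (1 + ε)) *
      ∫⁻ t in S, ENNReal.ofReal ‖deriv c t‖) (nhdsWithin 0 (Set.Ioi 0))
      (nhds (ENNReal.ofReal ((1 - 0) / (1 + 0)) * ∫⁻ t in S, ENNReal.ofReal ‖deriv c t‖)) := by
    refine ENNReal.Tendsto.mul_const ?_ (Or.inl (by simp))
    refine ENNReal.tendsto_ofReal ?_
    have : ContinuousAt (fun ε : ℝ => (1 - ε) / (1 + ε)) 0 := by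
      refine ContinuousAt.div ?_ ?_ (by norm_num) <;> fun_prop
    exact this.tendsto.mono_left nhdsWithin_le_nhds
  have := le_of_tendsto hlim (b := μH[1] (c '' S)) (by
    filter_upwards [Ioo_mem_nhdsGT (zero_lt_one (α := ℝ))] with ε hε
    exact key ε hε.1 hε.2)
  simpa using this

/-- A one-to-one measurable parametrization of a planar set by arclength-controlled pieces. -/
structure WiPar (K : Set (EuclideanSpace ℝ (Fin 2))) (E : Set ℝ) (X Y X' Y' : ℝ → ℝ) : Prop where
  measE : MeasurableSet E
  mX : Measurable X
  mY : Measurable Y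
  mX' : Measurable X'
  mY' : Measurable Y'
  dX : ∀ s ∈ E, HasDerivWithinAt X (X' s) E s
  dY : ∀ s ∈ E, HasDerivWithinAt Y (Y' s) E s
  reg : ∀ s ∈ E, 0 < X' s ^ 2 + Y' s ^ 2
  img : ∀ s ∈ E, !₂[X s, Y s] ∈ K
  surj : ∀ z ∈ K, ∃ s ∈ E, X s = z 0 ∧ Y s = z 1
  cost : ∀ g : EuclideanSpace ℝ (Fin 2) → ENNReal, Measurable g →
    ∫⁻ s in E, g !₂[X s, Y s] * ENNReal.ofReal (√(X' s ^ 2 + Y' s ^ 2)) ≤ ∫⁻ x in K, g x ∂μH[1]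

lemma wi_pieces (n : ℕ) (γ : Fin n → ℝ → EuclideanSpace ℝ (Fin 2))
    (h1 : ∀ i, ContDiff ℝ 2 (γ i)) (h2 : ∀ i, Function.Periodic (γ i) 1)
    (h3 : ∀ i t, deriv (γ i) t ≠ 0) :
    ∃ (M : ℕ) (c : ℕ → ℝ → EuclideanSpace ℝ (Fin 2)), (∀ l, ContDiff ℝ 1 (c l)) ∧
      (∀ l t, deriv (c l) t ≠ 0) ∧ (∀ l, Set.InjOn (c l) (Set.Icc (2 * l : ℝ) (2 * l + 1))) ∧
      (⋃ i, Set.range (γ i)) = ⋃ l ∈ Finset.range M, c l '' Set.Icc (2 * l : ℝ) (2 * l + 1) := by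
  choose N hN hun using fun i => wi_unif (γ i) ((h1 i).of_le (by norm_num)) (h3 i) 0 1 zero_le_one (1/2)
    (by norm_num)
  let ι := Σ i : Fin n, Fin (N i)
  let e : ι ≃ Fin (Fintype.card ι) := Fintype.equivFin ι
  let M := Fintype.card ι
  let cc : ι → ℕ → ℝ → EuclideanSpace ℝ (Fin 2) := fun x l s =>
    γ x.1 ((1 / (N x.1) : ℝ) * s + ((x.2 : ℕ) - 2 * l) / (N x.1))
  let c : ℕ → ℝ → EuclideanSpace ℝ (Fin 2) := fun l => if h : l < M then
      cc (e.symm ⟨l, h⟩) l else fun s => s • !₂[1, 0]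
  have hcl : ∀ l (h : l < M), c l = fun s => γ (e.symm ⟨l, h⟩).1 ((1 / (N (e.symm ⟨l, h⟩).1) : ℝ) * s +
        (((e.symm ⟨l, h⟩).2 : ℕ) - 2 * l) / (N (e.symm ⟨l, h⟩).1)) := fun l h => by
    simp only [c, cc, h, dif_pos]
  have hcl' : ∀ l (h : ¬ l < M), c l = fun s => s • !₂[1, 0] := fun l h => by
    simp only [c, h, dif_neg, not_false_eq_true]
  refine ⟨M, c, ?_, ?_, ?_, ?_⟩
  · intro l
    by_cases h : l < M
    · rw [hcl l h]
      have := (h1 (e.symm ⟨l, h⟩).1).of_le (m := 1) (by norm_num)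
      exact this.comp (by fun_prop)
    · rw [hcl' l h]; fun_prop
  · intro l t
    by_cases h : l < M
    · rw [hcl l h]
      have hd := ((h1 (e.symm ⟨l, h⟩).1).differentiable (by norm_num)
        ((1 / (N (e.symm ⟨l, h⟩).1) : ℝ) * t +
        (((e.symm ⟨l, h⟩).2 : ℕ) - 2 * l) / (N (e.symm ⟨l, h⟩).1))).hasDerivAt
      have hd2 : HasDerivAt (fun s : ℝ => (1 / (N (e.symm ⟨l, h⟩).1) : ℝ) * s +
        (((e.symm ⟨l, h⟩).2 : ℕ) - 2 * l) / (N (e.symm ⟨l, h⟩).1))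
          (1 / (N (e.symm ⟨l, h⟩).1) : ℝ) t := by
        simpa using ((hasDerivAt_id t).const_mul (1 / (N (e.symm ⟨l, h⟩).1) : ℝ)).add_const ((((e.symm ⟨l, h⟩).2 : ℕ) - 2 * l : ℝ) / (N (e.symm ⟨l, h⟩).1))
      have hd3 := hd.scomp t hd2
      have hd4 := hd3.deriv
      simp only [Function.comp_def] at hd4
      rw [hd4]
      refine smul_ne_zero ?_ (h3 _ _)
      have := hN (e.symm ⟨l, h⟩).1
      positivity
    · rw [hcl' l h]
      have := ((hasDerivAt_id t).smul_const (!₂[1, 0] : EuclideanSpace ℝ (Fin 2))).deriv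
      simp only [id] at this
      rw [this, one_smul]
      intro h0
      have := congrArg (fun z => z 0) h0
      simp at this
  · intro l
    by_cases h : l < M
    · rw [hcl l h]
      set i := (e.symm ⟨l, h⟩).1
      set j := (e.symm ⟨l, h⟩).2
      have hNi : (0:ℝ) < N i := by exact_mod_cast hN i
      have hj : ((j : ℕ) : ℝ) + 1 ≤ N i := by exact_mod_cast j.2
      have hj0 : (0 : ℝ) ≤ ((j : ℕ) : ℝ) := by positivity
      have hI : ∀ s ∈ Set.Icc (2 * l : ℝ) (2 * l + 1),
          (1 / (N i) : ℝ) * s + (((j : ℕ) : ℝ) - 2 * l) / (N i) ∈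
            Set.Icc ((j : ℕ) / N i : ℝ) (((j : ℕ) + 1) / N i) := by
        intro s hs
        have : (1 / (N i) : ℝ) * s + (((j : ℕ) : ℝ) - 2 * l) / (N i)
          = ((j : ℕ) + (s - 2 * l)) / N i := by field_simp; ring
        rw [this]
        constructor
        · gcongr; linarith [hs.1]
        · gcongr; linarith [hs.2]
      have hsub : ∀ t ∈ Set.Icc ((j : ℕ) / N i : ℝ) (((j : ℕ) + 1) / N i),
          t ∈ Set.Icc (0:ℝ) 1 := by
        intro t ht
        exact ⟨le_trans (by positivity) ht.1, ht.2.trans (by rw [div_le_one hNi]; exact hj)⟩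
      have hmid : ((j : ℕ) / N i : ℝ) ∈ Set.Icc ((j : ℕ) / N i : ℝ) (((j : ℕ) + 1) / N i) :=
        ⟨le_rfl, by gcongr; linarith⟩
      have hal := wi_antilip (γ i) ((h1 i).differentiable (by norm_num)) _
        (convex_Icc ((j : ℕ) / N i : ℝ) (((j : ℕ) + 1) / N i)) (deriv (γ i) ((j : ℕ) / N i : ℝ)) (1/2)
        (fun t ht => hun i _ (hsub _ hmid) t (hsub t ht) (by
          have h1 := ht.1; have h2 := ht.2
          rw [abs_sub_comm, abs_of_nonneg (by linarith)]
          rw [add_div] at h2; linarith))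
      intro s hs t ht hst
      have h5 := hal _ (hI s hs) _ (hI t ht)
      simp only at hst
      rw [hst, sub_self, norm_zero] at h5
      have hv : 0 < ‖deriv (γ i) ((j : ℕ) / N i : ℝ)‖ := norm_pos_iff.2 (h3 _ _)
      have h6 : |1 / (N i : ℝ) * s + (((j : ℕ) : ℝ) - 2 * l) / (N i) -
        (1 / (N i : ℝ) * t + (((j : ℕ) : ℝ) - 2 * l) / (N i))| ≤ 0 := by
        by_contra! h7
        have := mul_pos hv h7
        nlinarith
      have h8 := abs_nonpos_iff.1 h6
      have h9 : (1 / (N i) : ℝ) * (s - t) = 0 := by linarith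
      rcases mul_eq_zero.1 h9 with h10 | h10
      · exact absurd h10 (by positivity)
      · linarith
    · rw [hcl' l h]
      intro s _ t _ hst
      have := congrArg (fun z => z 0) hst
      simpa using this
  · ext z
    simp only [Set.mem_iUnion, Set.mem_range, Finset.mem_range, Set.mem_image, exists_prop]
    constructor
    · rintro ⟨i, t, rfl⟩
      have hNi : (0:ℝ) < N i := by exact_mod_cast hN i
      obtain ⟨t', ht', hteq⟩ := (h2 i).exists_mem_Ico₀ zero_lt_one t
      have hfl : ⌊t' * N i⌋₊ < N i := by
        rw [Nat.floor_lt (by have := ht'.1; positivity)]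
        nlinarith [ht'.2]
      let x : ι := ⟨i, ⟨⌊t' * N i⌋₊, hfl⟩⟩
      refine ⟨e x, (e x).2, 2 * (e x : ℕ) + (t' * N i - ⌊t' * N i⌋₊), ⟨?_, ?_⟩, ?_⟩
      · have := Nat.floor_le (show 0 ≤ t' * N i by have := ht'.1; positivity)
        linarith
      · have := Nat.lt_floor_add_one (t' * N i)
        linarith
      · rw [hcl _ (e x).2]
        have : e.symm ⟨(e x : ℕ), (e x).2⟩ = x := by simp
        rw [hteq]
        show cc (e.symm ⟨(e x : ℕ), (e x).2⟩) _ _ = _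
        rw [this]
        show γ i ((1 / (N i) : ℝ) * (2 * (e x : ℕ) + (t' * N i - ⌊t' * N i⌋₊)) +
          ((⌊t' * N i⌋₊ : ℕ) - 2 * (e x : ℕ)) / (N i)) = _
        congr 1
        field_simp
        ring
    · rintro ⟨l, hl, s, hs, rfl⟩
      rw [hcl l hl]
      exact ⟨_, _, rfl⟩

lemma wi_norm (z : EuclideanSpace ℝ (Fin 2)) : ‖z‖ = √(z 0 ^ 2 + z 1 ^ 2) := by
  rw [EuclideanSpace.norm_eq]; simp

lemma wi_eta (z : EuclideanSpace ℝ (Fin 2)) : !₂[z 0, z 1] = z := by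
  ext i; fin_cases i <;> simp

lemma wi_par_exists (K : Set (EuclideanSpace ℝ (Fin 2))) (M : ℕ)
    (c : ℕ → ℝ → EuclideanSpace ℝ (Fin 2)) (h1 : ∀ l, ContDiff ℝ 1 (c l))
    (h2 : ∀ l t, deriv (c l) t ≠ 0)
    (h3 : ∀ l, Set.InjOn (c l) (Set.Icc (2 * l : ℝ) (2 * l + 1)))
    (hK : K = ⋃ l ∈ Finset.range M, c l '' Set.Icc (2 * l : ℝ) (2 * l + 1)) :
    ∃ (E : Set ℝ) (X Y X' Y' : ℝ → ℝ), WiPar K E X Y X' Y' := by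
  let idx : ℝ → ℕ := fun s => ⌊s / 2⌋₊
  have hidxm : Measurable idx := Nat.measurable_floor.comp (measurable_id.div_const 2)
  have hidx : ∀ (l : ℕ) (s : ℝ), s ∈ Set.Icc (2 * l : ℝ) (2 * l + 1) → idx s = l := by
    intro l s hs
    have h0 : 0 ≤ s / 2 := by have := hs.1; have : (0:ℝ) ≤ l := by positivity
                              linarith
    rw [Nat.floor_eq_iff h0]
    constructor <;> linarith [hs.1, hs.2]
  let Γ : ℝ → EuclideanSpace ℝ (Fin 2) := fun s => c (idx s) s
  let Γ' : ℝ → EuclideanSpace ℝ (Fin 2) := fun s => deriv (c (idx s)) s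
  have hΓm : Measurable Γ := by
    have : Measurable (fun q : ℝ × ℕ => c q.2 q.1) :=
      measurable_from_prod_countable_left fun l => (h1 l).continuous.measurable
    exact this.comp (measurable_id.prodMk hidxm)
  have hΓ'm : Measurable Γ' := by
    have : Measurable (fun q : ℝ × ℕ => deriv (c q.2) q.1) :=
      measurable_from_prod_countable_left fun l => ((h1 l).continuous_deriv le_rfl).measurable
    exact this.comp (measurable_id.prodMk hidxm)
  let U : ℕ → Set (EuclideanSpace ℝ (Fin 2)) := fun l =>
    ⋃ l' ∈ Finset.range l, c l' '' Set.Icc (2 * l' : ℝ) (2 * l' + 1)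
  have hU : ∀ l, IsClosed (U l) := fun l => by
    refine (Finset.isCompact_biUnion _ fun l' _ => ?_).isClosed
    exact isCompact_Icc.image (h1 l').continuous
  let P : ℕ → Set ℝ := fun l => Set.Icc (2 * l : ℝ) (2 * l + 1) ∩ (c l ⁻¹' U l)ᶜ
  let E : Set ℝ := ⋃ l ∈ Finset.range M, P l
  have hPm : ∀ l, MeasurableSet (P l) := fun l =>
    measurableSet_Icc.inter ((hU l).preimage (h1 l).continuous).measurableSet.compl
  have hEm : MeasurableSet E := Finset.measurableSet_biUnion _ fun l _ => hPm l
  have hE : ∀ s ∈ E, idx s < M ∧ s ∈ Set.Icc (2 * (idx s) : ℝ) (2 * (idx s) + 1) ∧ Γ s ∉ U (idx s) := by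
    intro s hs
    simp only [E, Set.mem_iUnion, Finset.mem_range, exists_prop] at hs
    obtain ⟨l, hl, hs1, hs2⟩ := hs
    have := hidx l s hs1
    simp only [Γ, this]
    exact ⟨hl, hs1, hs2⟩
  have hder : ∀ s ∈ E, HasDerivWithinAt Γ (Γ' s) E s := by
    intro s hs
    have h4 : HasDerivWithinAt (c (idx s)) (deriv (c (idx s)) s) E s :=
      ((h1 _).differentiable one_ne_zero s).hasDerivAt.hasDerivWithinAt
    refine h4.congr_of_eventuallyEq ?_ rfl
    filter_upwards [inter_mem_nhdsWithin E (Metric.ball_mem_nhds s one_half_pos)] with t ht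
    have ha := (hE s hs).2.1
    have hb := (hE t ht.1).2.1
    have hd := ht.2
    rw [Metric.mem_ball, Real.dist_eq, abs_lt] at hd
    have : idx t = idx s := by
      rcases lt_trichotomy (idx t) (idx s) with h | h | h
      · have : (idx t : ℝ) + 1 ≤ idx s := by exact_mod_cast h
        linarith [ha.1, hb.2]
      · exact h
      · have : (idx s : ℝ) + 1 ≤ idx t := by exact_mod_cast h
        linarith [ha.2, hb.1]
    simp only [Γ, this]
  have hinj : Set.InjOn Γ E := by
    have haux : ∀ s ∈ E, ∀ t ∈ E, Γ s = Γ t → ¬ idx s < idx t := by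
      intro s hs t ht hst hlt
      apply (hE t ht).2.2
      rw [← hst]
      simp only [U, Set.mem_iUnion, Finset.mem_range, exists_prop]
      exact ⟨idx s, hlt, s, (hE s hs).2.1, rfl⟩
    intro s hs t ht hst
    have h5 : idx s = idx t := by
      have := haux s hs t ht hst
      have := haux t ht s hs hst.symm
      omega
    have h6 := (hE t ht).2.1
    rw [← h5] at h6
    refine h3 (idx s) (hE s hs).2.1 h6 ?_
    have : c (idx s) s = c (idx t) t := hst
    rw [this, h5]
  have hsurj : ∀ z ∈ K, ∃ s ∈ E, Γ s = z := by
    intro z hz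
    rw [hK] at hz
    simp only [Set.mem_iUnion, Finset.mem_range, exists_prop] at hz
    classical
    have h5 := Nat.find_spec hz
    have h6 := fun l' => Nat.find_min hz (m := l')
    obtain ⟨hl, s, hs, hsz⟩ := h5
    refine ⟨s, ?_, ?_⟩
    · simp only [E, Set.mem_iUnion, Finset.mem_range, exists_prop]
      refine ⟨_, hl, hs, ?_⟩
      simp only [U, Set.mem_compl_iff, Set.mem_preimage, Set.mem_iUnion, Finset.mem_range,
        exists_prop, not_exists, not_and]
      intro l' hl' hmem
      exact h6 l' hl' ⟨hl'.trans hl, hsz ▸ hmem⟩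
    · simp only [Γ]
      rw [hidx _ s hs]; exact hsz
  have himg : ∀ s ∈ E, Γ s ∈ K := by
    intro s hs
    rw [hK]
    simp only [Set.mem_iUnion, Finset.mem_range, exists_prop]
    exact ⟨_, (hE s hs).1, s, (hE s hs).2.1, rfl⟩
  have hcost : ∀ T ⊆ E, MeasurableSet T → ∫⁻ s in T, ENNReal.ofReal ‖Γ' s‖ ≤ μH[1] (Γ '' T) := by
    intro T hTE hT
    let I : ℕ → Set ℝ := fun l => T ∩ idx ⁻¹' {l}
    have hIm : ∀ l, MeasurableSet (I l) := fun l => hT.inter (hidxm (measurableSet_singleton l))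
    have hId : Pairwise (Function.onFun Disjoint I) := by
      intro i j hij
      refine Set.disjoint_left.2 fun t h1 h2 => hij (h1.2.symm.trans h2.2)
    have hIU : T = ⋃ j, I j := by
      ext t; simp [I]
    have hI1 : ∀ l, Set.EqOn Γ (c l) (I l) := by
      intro l s hs
      have : idx s = l := hs.2
      simp only [Γ, this]
    have hpiece : ∀ l, ∫⁻ t in I l, ENNReal.ofReal ‖Γ' t‖ ≤ μH[1] (Γ '' I l) := by
      intro l
      have hsub : I l ⊆ Set.Icc (2 * l : ℝ) (2 * l + 1) := by
        intro s hs
        have h6 := (hE s (hTE hs.1)).2.1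
        have : idx s = l := hs.2
        rwa [this] at h6
      have h7 := wi_arc_le (c l) (h1 l) (h2 l) (I l) (hIm l) _ _ (by linarith) hsub ((h3 l).mono hsub)
      rw [(hI1 l).image_eq]
      refine le_trans (le_of_eq ?_) h7
      refine setLIntegral_congr_fun (hIm l) fun s hs => ?_
      have : idx s = l := hs.2
      simp only [Γ', this]
    have hUn : Γ '' T = ⋃ j, Γ '' I j := by rw [← Set.image_iUnion, ← hIU]
    rw [hUn, measure_iUnion]
    · conv_lhs => rw [hIU]
      rw [lintegral_iUnion hIm hId]
      exact ENNReal.tsum_le_tsum hpiece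
    · intro i j hij
      exact Set.disjoint_image_image (fun s hs t ht hst =>
        (Set.disjoint_left.1 (hId hij) hs) (by
          have := hinj (hTE hs.1) (hTE ht.1) hst
          rw [this]; exact ht))
    · intro j
      exact (hIm j).image_of_continuousOn_injOn
        (fun s hs => ((hder s (hTE hs.1)).continuousWithinAt.mono
          (Set.inter_subset_left.trans hTE)))
        (hinj.mono (Set.inter_subset_left.trans hTE))
  have hn : ∀ s, √(Γ' s 0 ^ 2 + Γ' s 1 ^ 2) = ‖Γ' s‖ := fun s => (wi_norm _).symm
  have hcoord : ∀ i : Fin 2, Measurable (fun z : EuclideanSpace ℝ (Fin 2) => z i) :=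
    fun i => by fun_prop
  refine ⟨E, fun s => Γ s 0, fun s => Γ s 1, fun s => Γ' s 0, fun s => Γ' s 1,
    hEm, (hcoord 0).comp hΓm, (hcoord 1).comp hΓm, (hcoord 0).comp hΓ'm, (hcoord 1).comp hΓ'm,
    ?_, ?_, ?_, ?_, ?_, ?_⟩
  · intro s hs
    exact (EuclideanSpace.proj 0 : EuclideanSpace ℝ (Fin 2) →L[ℝ] ℝ).hasFDerivAt.comp_hasDerivWithinAt s (hder s hs)
  · intro s hs
    exact (EuclideanSpace.proj 1 : EuclideanSpace ℝ (Fin 2) →L[ℝ] ℝ).hasFDerivAt.comp_hasDerivWithinAt s (hder s hs)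
  · intro s hs
    have h0 : 0 < ‖Γ' s‖ := norm_pos_iff.2 (h2 _ _)
    rw [← hn] at h0
    exact Real.sqrt_pos.1 h0
  · intro s hs
    rw [wi_eta]; exact himg s hs
  · intro z hz
    obtain ⟨s, hs, rfl⟩ := hsurj z hz
    exact ⟨s, hs, rfl, rfl⟩
  · intro g hg
    simp only [wi_eta, hn]
    let ν : Measure ℝ := (volume.restrict E).withDensity (fun s => ENNReal.ofReal ‖Γ' s‖)
    have hle : ν.map Γ ≤ μH[1].restrict K := by
      refine Measure.le_iff.2 fun T hT => ?_
      rw [Measure.map_apply hΓm hT, withDensity_apply _ (hΓm hT), Measure.restrict_apply hT,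
        Measure.restrict_restrict (hΓm hT)]
      refine (hcost _ Set.inter_subset_right ((hΓm hT).inter hEm)).trans (measure_mono ?_)
      rintro _ ⟨s, hs, rfl⟩
      exact ⟨hs.1, himg s hs.2⟩
    calc ∫⁻ s in E, g (Γ s) * ENNReal.ofReal ‖Γ' s‖ = ∫⁻ s, g (Γ s) ∂ν := by
          show _ = ∫⁻ s, (g ∘ Γ) s ∂((volume.restrict E).withDensity (fun s => ENNReal.ofReal ‖Γ' s‖))
          rw [lintegral_withDensity_eq_lintegral_mul _ hΓ'm.norm.ennreal_ofReal (hg.comp hΓm)]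
          simp only [Pi.mul_apply, mul_comm, Function.comp]
      _ = ∫⁻ x, g x ∂(ν.map Γ) := (lintegral_map hg hΓm).symm
      _ ≤ _ := lintegral_mono' hle le_rfl

lemma wi_cover (Z : Set (ℝ × ℝ)) (hZ : MeasurableSet Z) (A B a b c d : ℝ × ℝ → ℝ)
    (hA : ∀ z ∈ Z, HasFDerivWithinAt A
      (a z • ContinuousLinearMap.fst ℝ ℝ ℝ + b z • ContinuousLinearMap.snd ℝ ℝ ℝ) Z z)
    (hB : ∀ z ∈ Z, HasFDerivWithinAt B
      (c z • ContinuousLinearMap.fst ℝ ℝ ℝ + d z • ContinuousLinearMap.snd ℝ ℝ ℝ) Z z)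
    (W : Set (EuclideanSpace ℝ (Fin 2)))
    (hW : ∀ w ∈ W, ∃ z ∈ Z, A z = w 0 ∧ B z = w 1) :
    volume W ≤ ∫⁻ z in Z, ENNReal.ofReal |a z * d z - b z * c z| := by
  have hmp : MeasurePreserving (fun w : EuclideanSpace ℝ (Fin 2) => (w 0, w 1)) :=
    (volume_preserving_finTwoArrow ℝ).comp (PiLp.volume_preserving_ofLp (Fin 2))
  have hsub : W ⊆ (fun w : EuclideanSpace ℝ (Fin 2) => (w 0, w 1)) ⁻¹'
      ((fun z => (A z, B z)) '' Z) := by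
    intro w hw
    obtain ⟨z, hz, h1, h2⟩ := hW w hw
    exact ⟨z, hz, by simp [h1, h2]⟩
  have hc : ContinuousOn (fun z => (A z, B z)) Z := fun z hz =>
    ((hA z hz).continuousWithinAt).prodMk (hB z hz).continuousWithinAt
  have himg : volume ((fun w : EuclideanSpace ℝ (Fin 2) => (w 0, w 1)) ⁻¹'
      ((fun z => (A z, B z)) '' Z)) ≤ volume ((fun z => (A z, B z)) '' Z) := by
    obtain ⟨T, hT1, hT2, hT3⟩ := exists_measurable_superset volume ((fun z => (A z, B z)) '' Z)
    rw [← hT3, ← hmp.measure_preimage hT2.nullMeasurableSet]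
    exact measure_mono (Set.preimage_mono hT1)
  refine (measure_mono hsub).trans (himg.trans ?_)
  let f' : ℝ × ℝ → (ℝ × ℝ →L[ℝ] ℝ × ℝ) := fun z =>
    (Matrix.toLin (.finTwoProd ℝ) (.finTwoProd ℝ)
      !![a z, b z; c z, d z]).toContinuousLinearMap
  have hf' : ∀ z ∈ Z, HasFDerivWithinAt (fun z => (A z, B z)) (f' z) Z z := by
    intro z hz
    have := (hA z hz).prodMk (hB z hz)
    simp only [f']
    rw [Matrix.toLin_finTwoProd_toContinuousLinearMap]
    exact this
  refine (addHaar_image_le_lintegral_abs_det_fderiv volume hZ hf').trans (le_of_eq ?_)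
  refine lintegral_congr fun z => ?_
  simp only [f', LinearMap.det_toContinuousLinearMap, LinearMap.det_toLin,
    Matrix.det_fin_two_of]

lemma wi_region (S : Set ℝ) (hS : MeasurableSet S) (a b : ℝ → ℝ) (ha : Measurable a)
    (hb : Measurable b) (F : ℝ × ℝ → ENNReal) (hF : Measurable F) :
    ∫⁻ z in {z : ℝ × ℝ | z.1 ∈ S ∧ z.2 ∈ Set.Icc (a z.1) (b z.1)}, F z =
      ∫⁻ s in S, ∫⁻ l in Set.Icc (a s) (b s), F (s, l) := by
  have hZ := measurableSet_region_between_cc ha hb hS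
  rw [← lintegral_indicator hZ, Measure.volume_eq_prod, lintegral_prod _
    (hF.indicator hZ).aemeasurable, ← lintegral_indicator hS]
  refine lintegral_congr fun s => ?_
  by_cases hs : s ∈ S
  · rw [Set.indicator_of_mem hs, ← lintegral_indicator measurableSet_Icc]
    refine lintegral_congr fun l => ?_
    simp [Set.indicator, hs]
  · rw [Set.indicator_of_notMem hs]
    simp [Set.indicator, hs]

section
variable {K : Set (EuclideanSpace ℝ (Fin 2))} {E : Set ℝ} {X Y X' Y' : ℝ → ℝ}

lemma wi_fd1 {E : Set ℝ} {X X' : ℝ → ℝ} (dX : ∀ s ∈ E, HasDerivWithinAt X (X' s) E s)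
    (Z : Set (ℝ × ℝ)) (hZ : ∀ z ∈ Z, z.1 ∈ E) (z : ℝ × ℝ) (hz : z ∈ Z) :
    HasFDerivWithinAt (fun z : ℝ × ℝ => X z.1) (X' z.1 • ContinuousLinearMap.fst ℝ ℝ ℝ) Z z :=
  (dX z.1 (hZ z hz)).comp_hasFDerivWithinAt z hasFDerivWithinAt_fst hZ

lemma wi_radial (h : WiPar K E X Y X' Y') (S : Set ℝ) (hS : MeasurableSet S) (hSE : S ⊆ E)
    (a b : ℝ → ℝ) (ha : Measurable a) (hb : Measurable b) (ha0 : ∀ s ∈ S, 0 ≤ a s)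
    (hab : ∀ s ∈ S, a s ≤ b s)
    (W : Set (EuclideanSpace ℝ (Fin 2)))
    (hW : ∀ w ∈ W, ∃ s ∈ S, ∃ l ∈ Set.Icc (a s) (b s), w 0 = l * X s ∧ w 1 = l * Y s) :
    volume W ≤ ∫⁻ s in S, ENNReal.ofReal (|X s * Y' s - Y s * X' s| * ((b s ^ 2 - a s ^ 2) / 2)) := by
  have hm1 := h.mX; have hm2 := h.mY; have hm3 := h.mX'; have hm4 := h.mY'
  let Z : Set (ℝ × ℝ) := {z : ℝ × ℝ | z.1 ∈ S ∧ z.2 ∈ Set.Icc (a z.1) (b z.1)}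
  have hZ : MeasurableSet Z := measurableSet_region_between_cc ha hb hS
  have hZE : ∀ z ∈ Z, z.1 ∈ E := fun z hz => hSE hz.1
  have key := wi_cover Z hZ (fun z => z.2 * X z.1) (fun z => z.2 * Y z.1)
    (fun z => z.2 * X' z.1) (fun z => X z.1) (fun z => z.2 * Y' z.1) (fun z => Y z.1)
    (fun z hz => by
      have := (hasFDerivWithinAt_snd (𝕜 := ℝ) (p := z) (s := Z)).mul (wi_fd1 h.dX Z hZE z hz)
      rw [smul_smul] at this
      exact this)
    (fun z hz => by
      have := (hasFDerivWithinAt_snd (𝕜 := ℝ) (p := z) (s := Z)).mul (wi_fd1 h.dY Z hZE z hz)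
      rw [smul_smul] at this
      exact this) W
    (fun w hw => by
      obtain ⟨s, hs, l, hl, h1, h2⟩ := hW w hw
      exact ⟨(s, l), ⟨hs, hl⟩, h1.symm, h2.symm⟩)
  refine key.trans (le_of_eq ?_)
  rw [wi_region S hS a b ha hb _ (by fun_prop)]
  refine setLIntegral_congr_fun hS fun s hs => ?_
  have h1 : ∀ l ∈ Set.Icc (a s) (b s), ENNReal.ofReal |l * X' s * Y s - X s * (l * Y' s)| =
      ENNReal.ofReal (|X s * Y' s - Y s * X' s| * l) := by
    intro l hl
    have : l * X' s * Y s - X s * (l * Y' s) = -((X s * Y' s - Y s * X' s) * l) := by ring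
    rw [this, abs_neg, abs_mul, abs_of_nonneg ((ha0 s hs).trans hl.1)]
  simp only
  rw [setLIntegral_congr_fun measurableSet_Icc h1, ← ofReal_integral_eq_lintegral_ofReal]
  · rw [integral_const_mul, integral_Icc_eq_integral_Ioc, ← intervalIntegral.integral_of_le (hab s hs),
      integral_id]
  · exact (Continuous.integrableOn_Icc (by fun_prop))
  · filter_upwards [ae_restrict_mem measurableSet_Icc] with l hl
    exact mul_nonneg (abs_nonneg _) ((ha0 s hs).trans hl.1)

lemma wi_schmidt0 (h : WiPar K E X Y X' Y') (c : ℝ)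
    (W : Set (EuclideanSpace ℝ (Fin 2)))
    (hW : ∀ w ∈ W, ∃ s ∈ E, ∃ l ∈ Set.Icc (0:ℝ) 1, w 0 = c + l * (X s - c) ∧ w 1 = Y s) :
    volume W ≤ ∫⁻ s in E, ENNReal.ofReal (|X s - c| * |Y' s|) := by
  have hm1 := h.mX; have hm2 := h.mY; have hm3 := h.mX'; have hm4 := h.mY'
  have ha : Measurable (fun _ : ℝ => (0:ℝ)) := measurable_const
  have hb : Measurable (fun _ : ℝ => (1:ℝ)) := measurable_const
  let Z : Set (ℝ × ℝ) := {z : ℝ × ℝ | z.1 ∈ E ∧ z.2 ∈ Set.Icc (0:ℝ) 1}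
  have hZ : MeasurableSet Z := measurableSet_region_between_cc ha hb h.measE
  have hZE : ∀ z ∈ Z, z.1 ∈ E := fun z hz => hz.1
  have key := wi_cover Z hZ (fun z => c + z.2 * (X z.1 - c)) (fun z => Y z.1)
    (fun z => z.2 * X' z.1) (fun z => X z.1 - c) (fun z => Y' z.1) (fun z => 0)
    (fun z hz => by
      have := ((hasFDerivWithinAt_snd (𝕜 := ℝ) (p := z) (s := Z)).mul
        ((wi_fd1 h.dX Z hZE z hz).sub_const c)).const_add c
      rw [smul_smul] at this
      exact this)
    (fun z hz => by simpa using wi_fd1 h.dY Z hZE z hz) W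
    (fun w hw => by
      obtain ⟨s, hs, l, hl, h1, h2⟩ := hW w hw
      exact ⟨(s, l), ⟨hs, hl⟩, h1.symm, h2.symm⟩)
  refine key.trans (le_of_eq ?_)
  rw [wi_region E h.measE _ _ ha hb _ (by fun_prop)]
  refine setLIntegral_congr_fun h.measE fun s hs => ?_
  simp [abs_mul]

lemma wi_schmidt1 (h : WiPar K E X Y X' Y') (c : ℝ)
    (W : Set (EuclideanSpace ℝ (Fin 2)))
    (hW : ∀ w ∈ W, ∃ s ∈ E, ∃ l ∈ Set.Icc (0:ℝ) 1, w 1 = c + l * (Y s - c) ∧ w 0 = X s) :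
    volume W ≤ ∫⁻ s in E, ENNReal.ofReal (|Y s - c| * |X' s|) := by
  have hm1 := h.mX; have hm2 := h.mY; have hm3 := h.mX'; have hm4 := h.mY'
  have ha : Measurable (fun _ : ℝ => (0:ℝ)) := measurable_const
  have hb : Measurable (fun _ : ℝ => (1:ℝ)) := measurable_const
  let Z : Set (ℝ × ℝ) := {z : ℝ × ℝ | z.1 ∈ E ∧ z.2 ∈ Set.Icc (0:ℝ) 1}
  have hZ : MeasurableSet Z := measurableSet_region_between_cc ha hb h.measE
  have hZE : ∀ z ∈ Z, z.1 ∈ E := fun z hz => hz.1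
  have key := wi_cover Z hZ (fun z => X z.1) (fun z => c + z.2 * (Y z.1 - c))
    (fun z => X' z.1) (fun z => 0) (fun z => z.2 * Y' z.1) (fun z => Y z.1 - c)
    (fun z hz => by simpa using wi_fd1 h.dX Z hZE z hz)
    (fun z hz => by
      have := ((hasFDerivWithinAt_snd (𝕜 := ℝ) (p := z) (s := Z)).mul
        ((wi_fd1 h.dY Z hZE z hz).sub_const c)).const_add c
      rw [smul_smul] at this
      exact this) W
    (fun w hw => by
      obtain ⟨s, hs, l, hl, h1, h2⟩ := hW w hw
      exact ⟨(s, l), ⟨hs, hl⟩, h2.symm, h1.symm⟩)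
  refine key.trans (le_of_eq ?_)
  rw [wi_region E h.measE _ _ ha hb _ (by fun_prop)]
  refine setLIntegral_congr_fun h.measE fun s hs => ?_
  simp [abs_mul, mul_comm]
end

lemma wi_line_image (S : Set ℝ) (hS : MeasurableSet S) (U U' : ℝ → ℝ)
    (hU : ∀ s ∈ S, HasDerivWithinAt U (U' s) S s) :
    volume (U '' S) ≤ ∫⁻ s in S, ENNReal.ofReal |U' s| := by
  have := addHaar_image_le_lintegral_abs_det_fderiv volume hS
    (fun s hs => (hU s hs).hasFDerivWithinAt)
  simpa using this

lemma wi_push (E : Set ℝ) (hE : MeasurableSet E) (U U' : ℝ → ℝ) (hUm : Measurable U)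
    (hUm' : Measurable U')
    (hU : ∀ s ∈ E, HasDerivWithinAt U (U' s) E s) (S : Set ℝ) (hS : MeasurableSet S) (hSE : S ⊆ E)
    (T : Set ℝ) (hT : MeasurableSet T) (hTS : T ⊆ U '' S) (G : ℝ → ENNReal) (hG : Measurable G) :
    ∫⁻ t in T, G t ≤ ∫⁻ s in S ∩ U ⁻¹' T, G (U s) * ENNReal.ofReal |U' s| := by
  set S' := S ∩ U ⁻¹' T with hS'def
  have hS' : MeasurableSet S' := hS.inter (hUm hT)
  let ν : Measure ℝ := (volume.restrict S').withDensity (fun s => ENNReal.ofReal |U' s|)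
  have hd : Measurable (fun s => ENNReal.ofReal |U' s|) := by fun_prop
  have hle : volume.restrict T ≤ ν.map U := by
    refine Measure.le_iff.2 fun A hA => ?_
    rw [Measure.map_apply hUm hA, withDensity_apply _ (hUm hA), Measure.restrict_apply hA,
        Measure.restrict_restrict (hUm hA)]
    refine le_trans (measure_mono ?_) (wi_line_image (U ⁻¹' A ∩ S') ((hUm hA).inter hS') U U'
      (fun s hs => (hU s (hSE hs.2.1)).mono fun t ht => hSE ht.2.1))
    intro t ht
    obtain ⟨s, hs, rfl⟩ := hTS ht.2
    exact ⟨s, ⟨ht.1, hs, ht.2⟩, rfl⟩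
  calc ∫⁻ t in T, G t ≤ ∫⁻ t, G t ∂(ν.map U) := lintegral_mono' hle le_rfl
    _ = ∫⁻ s, (G ∘ U) s ∂((volume.restrict S').withDensity (fun s => ENNReal.ofReal |U' s|)) :=
        lintegral_map hG hUm
    _ = _ := by
      rw [lintegral_withDensity_eq_lintegral_mul _ hd (hG.comp hUm)]
      simp only [Pi.mul_apply, mul_comm, Function.comp]

lemma wi_double {K : Set (EuclideanSpace ℝ (Fin 2))} {E : Set ℝ} {X Y X' Y' : ℝ → ℝ}
    (h : WiPar K E X Y X' Y') (hK : IsCompact K) (u : EuclideanSpace ℝ (Fin 2) → ℝ)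
    (hu : Continuous u) (U U' : ℝ → ℝ) (hUu : ∀ s, U s = u !₂[X s, Y s])
    (hUm : Measurable U) (hUm' : Measurable U')
    (hU : ∀ s ∈ E, HasDerivWithinAt U (U' s) E s) (V : Set ℝ)
    (hV : ∀ t ∈ V, ∃ z ∈ K, ∃ z' ∈ K, z ≠ z' ∧ u z = t ∧ u z' = t)
    (G : ℝ → ENNReal) (hG : Measurable G) :
    2 * ∫⁻ t in V, G t ≤ ∫⁻ s in E, G (U s) * ENNReal.ofReal |U' s| := by
  let ι := {x : Fin 2 × ℚ × ℚ // x.2.1 < x.2.2}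
  let T : ι → Set ℝ := fun x => u '' (K ∩ {z | z x.1.1 ≤ x.1.2.1}) ∩ u '' (K ∩ {z | (x.1.2.2 : ℝ) ≤ z x.1.1})
  have hTm : ∀ x, MeasurableSet (T x) := fun x => by
    refine MeasurableSet.inter ?_ ?_
    · refine ((hK.inter_right (isClosed_le ?_ ?_)).image hu).measurableSet <;> fun_prop
    · refine ((hK.inter_right (isClosed_le ?_ ?_)).image hu).measurableSet <;> fun_prop
  have : Nonempty ι := ⟨⟨(0, 0, 1), by norm_num⟩⟩
  obtain ⟨f, hf⟩ := exists_surjective_nat ι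
  let D : ℕ → Set ℝ := disjointed (fun n => T (f n))
  have hDm : ∀ n, MeasurableSet (D n) := fun n => MeasurableSet.disjointed (fun n => hTm (f n)) n
  have hDd : Pairwise (Function.onFun Disjoint D) := disjoint_disjointed _
  have hDT : ∀ n, D n ⊆ T (f n) := fun n => disjointed_subset _ n
  have hVD : V ⊆ ⋃ n, D n := by
    rw [iUnion_disjointed]
    intro t ht
    obtain ⟨z, hz, z', hz', hne, h1, h2⟩ := hV t ht
    have hex : ∃ i, z i ≠ z' i := by
      by_contra! hc
      exact hne (by ext i; exact hc i)
    obtain ⟨i, hi⟩ := hex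
    rw [Set.mem_iUnion]
    rcases lt_or_gt_of_ne hi with hlt | hlt
    · obtain ⟨r, hr1, hr2⟩ := exists_rat_btwn hlt
      obtain ⟨r', hr3, hr4⟩ := exists_rat_btwn hr2
      obtain ⟨n, hn⟩ := hf ⟨(i, r, r'), by exact_mod_cast hr3⟩
      refine ⟨n, ?_⟩
      simp only [hn, T]
      exact ⟨⟨z, ⟨hz, hr1.le⟩, h1⟩, ⟨z', ⟨hz', hr4.le⟩, h2⟩⟩
    · obtain ⟨r, hr1, hr2⟩ := exists_rat_btwn hlt
      obtain ⟨r', hr3, hr4⟩ := exists_rat_btwn hr2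
      obtain ⟨n, hn⟩ := hf ⟨(i, r, r'), by exact_mod_cast hr3⟩
      refine ⟨n, ?_⟩
      simp only [hn, T]
      exact ⟨⟨z', ⟨hz', hr1.le⟩, h2⟩, ⟨z, ⟨hz, hr4.le⟩, h1⟩⟩
  have hm1 := h.mX; have hm2 := h.mY
  have hpiece : ∀ n, 2 * ∫⁻ t in D n, G t ≤ ∫⁻ s in E ∩ U ⁻¹' D n, G (U s) * ENNReal.ofReal |U' s| := by
    intro n
    set x := f n
    have hΓ : Measurable (fun s => (!₂[X s, Y s] : EuclideanSpace ℝ (Fin 2)) x.1.1) := by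
      have : ∀ i : Fin 2, Measurable (fun s => (!₂[X s, Y s] : EuclideanSpace ℝ (Fin 2)) i) := by
        intro i
        fin_cases i
        · simpa using hm1
        · simpa using hm2
      exact this _
    let S1 := E ∩ {s | (!₂[X s, Y s] : EuclideanSpace ℝ (Fin 2)) x.1.1 ≤ x.1.2.1}
    let S2 := E ∩ {s | x.1.2.2 ≤ (!₂[X s, Y s] : EuclideanSpace ℝ (Fin 2)) x.1.1}
    have hS1 : MeasurableSet S1 := h.measE.inter (measurableSet_le hΓ measurable_const)
    have hS2 : MeasurableSet S2 := h.measE.inter (measurableSet_le measurable_const hΓ)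
    have hz : ∀ z ∈ K, ∃ s ∈ E, !₂[X s, Y s] = z := by
      intro z hz
      obtain ⟨s, hs, h1, h2⟩ := h.surj z hz
      exact ⟨s, hs, by rw [h1, h2, wi_eta]⟩
    have h1 := wi_push E h.measE U U' hUm hUm' hU S1 hS1 Set.inter_subset_left (D n) (hDm n)
      (fun t ht => by
        obtain ⟨⟨z, hz1, hz2⟩, -⟩ := hDT n ht
        obtain ⟨s, hs, rfl⟩ := hz z hz1.1
        exact ⟨s, ⟨hs, hz1.2⟩, by rw [hUu, hz2]⟩) G hG
    have h2 := wi_push E h.measE U U' hUm hUm' hU S2 hS2 Set.inter_subset_left (D n) (hDm n)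
      (fun t ht => by
        obtain ⟨-, ⟨z, hz1, hz2⟩⟩ := hDT n ht
        obtain ⟨s, hs, rfl⟩ := hz z hz1.1
        exact ⟨s, ⟨hs, hz1.2⟩, by rw [hUu, hz2]⟩) G hG
    rw [two_mul]
    refine (add_le_add h1 h2).trans ?_
    rw [← lintegral_union (hS2.inter (hUm (hDm n)))]
    · refine lintegral_mono_set ?_
      rintro s (hs | hs)
      · exact ⟨hs.1.1, hs.2⟩
      · exact ⟨hs.1.1, hs.2⟩
    · refine Set.disjoint_left.2 fun s hs1 hs2 => ?_
      have h3 := hs1.1.2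
      have h4 := hs2.1.2
      have h5 : (x.1.2.1 : ℝ) < x.1.2.2 := by exact_mod_cast x.2
      simp only [Set.mem_ofPred_eq] at h3 h4
      linarith
  calc 2 * ∫⁻ t in V, G t ≤ 2 * ∫⁻ t in ⋃ n, D n, G t := by gcongr
    _ = ∑' n, 2 * ∫⁻ t in D n, G t := by rw [lintegral_iUnion hDm hDd, ENNReal.tsum_mul_left]
    _ ≤ ∑' n, ∫⁻ s in E ∩ U ⁻¹' D n, G (U s) * ENNReal.ofReal |U' s| := ENNReal.tsum_le_tsum hpiece
    _ = ∫⁻ s in ⋃ n, E ∩ U ⁻¹' D n, G (U s) * ENNReal.ofReal |U' s| := by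
      rw [lintegral_iUnion (fun n => h.measE.inter (hUm (hDm n)))]
      intro i j hij
      exact ((hDd hij).preimage U).mono Set.inter_subset_right Set.inter_subset_right
    _ ≤ _ := lintegral_mono_set (Set.iUnion_subset fun n => Set.inter_subset_left)

lemma wi_chord (k : ℝ) (hk : 0 < k) (hk1 : k < 1) (α β a b q : ℝ) (ha : 0 < a)
    (haq : a < q) (hqb : q < b)
    (h1 : α * a + β = a ^ k) (h2 : α * b + β = b ^ k) : α * q + β < q ^ k := by
  have hsc := Real.strictConcaveOn_rpow hk hk1
  have hab : 0 < b - a := by linarith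
  have hp1 : 0 < (b - q) / (b - a) := div_pos (by linarith) hab
  have hp2 : 0 < (q - a) / (b - a) := div_pos (by linarith) hab
  have := hsc.2 (Set.mem_Ici.2 ha.le) (Set.mem_Ici.2 (show 0 ≤ b by linarith)) (by linarith)
    hp1 hp2 (by field_simp; ring)
  simp only [smul_eq_mul] at this
  rw [← h1, ← h2] at this
  have e1 : (b - q) / (b - a) * a + (q - a) / (b - a) * b = q := by field_simp; ring
  have e2 : (b - q) / (b - a) * (α * a + β) + (q - a) / (b - a) * (α * b + β) = α * q + β := by
    field_simp; ring
  rw [e1, e2] at this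
  exact this

lemma wi_chi0 (k q : ℝ) (hk : 0 < k) (hk1 : k < 1) (hq : 0 < q) (H V : ℝ → ℝ) (hh0 : 0 < H q)
    (hlt : H q < 1) (hdh : HasDerivAt H (V q / q) q)
    (hdv : HasDerivAt V ((k * (1 - k) * H q + (1 - 2 * k) * V q) / q) q) :
    ∃ d : ℝ, HasDerivAt (fun q : ℝ => arctan ((V q +
      (1 - 2 * k) / 2 * (arccos (H q) / √(1 - (H q) ^ 2) - H q)) /
        (√(k * (1 - k)) * √(1 - (H q) ^ 2)))) d q ∧
      d ≤ √(k * (1 - k)) * (H q / √(1 - (H q) ^ 2) / q) := by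
  set c := √(k * (1 - k)) with hc
  have hkk : 0 < k * (1 - k) := by nlinarith
  have hc0 : 0 < c := Real.sqrt_pos.2 hkk
  have hc2 : c ^ 2 = k * (1 - k) := Real.sq_sqrt hkk.le
  have hw2pos : 0 < 1 - H q ^ 2 := by nlinarith
  have hw0 : 0 < √(1 - H q ^ 2) := Real.sqrt_pos.2 hw2pos
  have hw2 : √(1 - H q ^ 2) ^ 2 = 1 - H q ^ 2 := Real.sq_sqrt hw2pos.le
  have hdw : HasDerivAt (fun q : ℝ => √(1 - (H q) ^ 2)) (-(H q * V q) / (√(1 - H q ^ 2) * q)) q := by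
    have h1 : HasDerivAt (fun q => 1 - H q ^ 2) (-(2 * H q * (V q / q))) q := by
      have := (hdh.fun_pow 2).const_sub 1
      refine this.congr_deriv ?_
      push_cast; ring
    refine (h1.sqrt hw2pos.ne').congr_deriv ?_
    field_simp
  have hdA : HasDerivAt (fun q : ℝ => arccos (H q)) (-(1 / √(1 - H q ^ 2)) * (V q / q)) q := by
    have h1 := Real.hasDerivAt_arccos (x := H q) (by linarith) hlt.ne
    exact HasDerivAt.comp (h₂ := arccos) q h1 hdh
  have hdg : HasDerivAt (fun q : ℝ => (1 - 2 * k) / 2 *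
      (arccos (H q) / √(1 - (H q) ^ 2) - H q)) ((H q * ((1 - 2 * k) / 2 *
      (arccos (H q) / √(1 - (H q) ^ 2) - H q)) / √(1 - H q ^ 2) ^ 2 - (1 - 2 * k)) * V q / q) q := by
    refine (((hdA.fun_div hdw hw0.ne').fun_sub hdh).const_mul ((1 - 2 * k) / 2)).congr_deriv ?_
    set w := √(1 - H q ^ 2)
    set h := H q
    set A := arccos h
    set v := V q
    field_simp
    ring_nf
    rw [show w ^ 3 = w * w ^ 2 by ring, hw2]
    ring
  have hdq := (hdv.fun_add hdg).fun_div (hdw.const_mul c) (by positivity)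
  have hd := hdq.arctan
  refine ⟨_, hd, ?_⟩
  set g := (1 - 2 * k) / 2 * (arccos (H q) / √(1 - (H q) ^ 2) - H q)
  set w := √(1 - H q ^ 2)
  set h := H q
  set v := V q
  set N := v + g with hN
  have key : 1 / (1 + (N / (c * w)) ^ 2) *
    ((((k * (1 - k) * h + (1 - 2 * k) * v) / q + (h * g / w ^ 2 - (1 - 2 * k)) * v / q) * (c * w) -
        N * (c * (-(h * v) / (w * q)))) / (c * w) ^ 2) =
      c * (h / w / q) * ((c ^ 2 * w ^ 2 - g ^ 2 + N ^ 2) / (c ^ 2 * w ^ 2 + N ^ 2)) := by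
    have h1 : c ^ 2 * w ^ 2 + N ^ 2 ≠ 0 := by positivity
    rw [← hc2]
    field_simp
    rw [hN]
    ring
  refine key.le.trans ?_
  have hle : (c ^ 2 * w ^ 2 - g ^ 2 + N ^ 2) / (c ^ 2 * w ^ 2 + N ^ 2) ≤ 1 := by
    rw [div_le_one (by positivity)]
    nlinarith [sq_nonneg g]
  calc _ ≤ c * (h / w / q) * 1 := by gcongr
    _ = _ := by ring

lemma wi_arcsin_div : Filter.Tendsto (fun w : ℝ => arcsin w / w) (nhdsWithin 0 (Set.Ioi 0)) (nhds 1) := by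
  have h := Real.hasDerivAt_arcsin (x := 0) (by norm_num) (by norm_num)
  rw [hasDerivAt_iff_tendsto_slope] at h
  have h2 := h.mono_left (nhdsWithin_mono (0:ℝ) (show Set.Ioi (0:ℝ) ⊆ {0}ᶜ from
    fun x hx => ne_of_gt hx))
  simp only [ne_eq, OfNat.ofNat_ne_zero, not_false_eq_true, zero_pow, sub_zero, sqrt_one, div_one] at h2
  refine h2.congr fun w => ?_
  simp [slope_def_field]

lemma wi_lim (k c v : ℝ) (hc : 0 < c) (l : Filter ℝ) (H V : ℝ → ℝ) (hH : Filter.Tendsto H l (nhds 1))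
    (hH1 : ∀ᶠ q in l, 0 < H q ∧ H q < 1) (hV : Filter.Tendsto V l (nhds v)) :
    Filter.Tendsto (fun q => V q + (1 - 2 * k) / 2 * (arccos (H q) / √(1 - (H q) ^ 2) - H q)) l (nhds v)
    ∧ Filter.Tendsto (fun q => (c * √(1 - (H q) ^ 2))⁻¹) l Filter.atTop := by
  have hw : Filter.Tendsto (fun q => √(1 - (H q) ^ 2)) l (nhdsWithin 0 (Set.Ioi 0)) := by
    refine tendsto_nhdsWithin_iff.2 ⟨?_, ?_⟩
    · have := ((hH.pow 2).const_sub 1).sqrt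
      simpa using this
    · filter_upwards [hH1] with q hq
      exact Real.sqrt_pos.2 (by nlinarith)
  constructor
  · have h1 := wi_arcsin_div.comp hw
    have h2 : Filter.Tendsto (fun q => arccos (H q) / √(1 - (H q) ^ 2)) l (nhds 1) := by
      refine h1.congr' ?_
      filter_upwards [hH1] with q hq
      simp only [Function.comp]
      rw [Real.arccos_eq_arcsin hq.1.le]
    have h3 := hV.add ((h2.sub hH).const_mul ((1 - 2 * k) / 2))
    simpa using h3
  · have h1 : Filter.Tendsto (fun q => c * √(1 - (H q) ^ 2)) l (nhdsWithin 0 (Set.Ioi 0)) := by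
      refine tendsto_nhdsWithin_iff.2 ⟨?_, ?_⟩
      · simpa using (tendsto_nhdsWithin_iff.1 hw).1.const_mul c
      · filter_upwards [(tendsto_nhdsWithin_iff.1 hw).2] with q hq
        exact mul_pos hc hq
    exact tendsto_inv_nhdsGT_zero.comp h1

lemma wi_inner0 (k qL qR : ℝ) (hk : 0 < k) (hk1 : k < 1) (hL : 0 < qL) (hLR : qL < qR) (H V : ℝ → ℝ)
    (hHc : ContinuousOn H (Set.Icc qL qR)) (hVc : ContinuousOn V (Set.Icc qL qR))
    (hH1 : ∀ q ∈ Set.Ioo qL qR, 0 < H q ∧ H q < 1)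
    (hdh : ∀ q ∈ Set.Ioo qL qR, HasDerivAt H (V q / q) q)
    (hdv : ∀ q ∈ Set.Ioo qL qR, HasDerivAt V ((k * (1 - k) * H q + (1 - 2 * k) * V q) / q) q)
    (hHL : H qL = 1) (hHR : H qR = 1) (hVL : V qL < 0) (hVR : 0 < V qR) :
    ENNReal.ofReal (π / √(k * (1 - k))) ≤
      ∫⁻ q in Set.Ioo qL qR, ENNReal.ofReal (H q / √(1 - H q ^ 2) / q) := by
  set c := √(k * (1 - k)) with hc
  have hkk : 0 < k * (1 - k) := by nlinarith
  have hc0 : 0 < c := Real.sqrt_pos.2 hkk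
  set I := ∫⁻ q in Set.Ioo qL qR, ENNReal.ofReal (H q / √(1 - H q ^ 2) / q) with hI
  let χ : ℝ → ℝ := fun q => arctan ((V q +
      (1 - 2 * k) / 2 * (arccos (H q) / √(1 - (H q) ^ 2) - H q)) /
        (c * √(1 - (H q) ^ 2)))
  have hder : ∀ q ∈ Set.Ioo qL qR, ∃ d, HasDerivAt χ d q ∧ d ≤ c * (H q / √(1 - (H q) ^ 2) / q) :=
    fun q hq => wi_chi0 k q hk hk1 (hL.trans hq.1) H V (hH1 q hq).1 (hH1 q hq).2 (hdh q hq) (hdv q hq)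
  choose! d hd1 hd2 using hder
  have hmain : ∀ a ∈ Set.Ioo qL qR, ∀ b ∈ Set.Ioo qL qR, a ≤ b →
      ENNReal.ofReal ((χ b - χ a) / c) ≤ I := by
    intro a ha b hb hab
    have hsub : Set.Icc a b ⊆ Set.Ioo qL qR := fun q hq => ⟨ha.1.trans_le hq.1, hq.2.trans_lt hb.2⟩
    have hcont : ContinuousOn (fun q => H q / √(1 - (H q) ^ 2) / q) (Set.Icc a b) := by
      have h1 : ContinuousOn H (Set.Icc a b) := hHc.mono (hsub.trans Set.Ioo_subset_Icc_self)
      refine (h1.div ((continuousOn_const.sub (h1.pow 2)).sqrt) ?_).div continuousOn_id ?_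
      · intro q hq
        have := hH1 q (hsub hq)
        have h5 : 0 < 1 - H q ^ 2 := by nlinarith
        exact (Real.sqrt_pos.2 h5).ne'
      · intro q hq
        exact (hL.trans (hsub hq).1).ne'
    have h1 := intervalIntegral.sub_le_integral_of_hasDeriv_right_of_le hab
      (g := χ) (g' := d) (φ := fun q => c * (H q / √(1 - (H q) ^ 2) / q))
      (fun q hq => (hd1 q (hsub hq)).continuousAt.continuousWithinAt)
      (fun q hq => (hd1 q (hsub (Set.Ioo_subset_Icc_self hq))).hasDerivWithinAt)
      ((hcont.integrableOn_Icc).const_mul c)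
      (fun q hq => hd2 q (hsub (Set.Ioo_subset_Icc_self hq)))
    rw [intervalIntegral.integral_const_mul] at h1
    have h2 : (χ b - χ a) / c ≤ ∫ q in a..b, (H q / √(1 - (H q) ^ 2) / q) := by
      rw [div_le_iff₀ hc0]; linarith
    refine (ENNReal.ofReal_le_ofReal h2).trans ?_
    rw [intervalIntegral.integral_of_le hab, ofReal_integral_eq_lintegral_ofReal]
    · exact lintegral_mono_set (Set.Ioc_subset_Icc_self.trans hsub)
    · exact hcont.integrableOn_Icc.mono_set Set.Ioc_subset_Icc_self
    · filter_upwards [ae_restrict_mem measurableSet_Ioc] with q hq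
      have h3 := hsub (Set.Ioc_subset_Icc_self hq)
      have h4 := hH1 q h3
      have h5 : 0 < q := hL.trans h3.1
      have := h4.1
      positivity
  have evR : ∀ᶠ q in nhdsWithin qR (Set.Iio qR), q ∈ Set.Ioo qL qR := Ioo_mem_nhdsLT hLR
  have evL : ∀ᶠ q in nhdsWithin qL (Set.Ioi qL), q ∈ Set.Ioo qL qR := Ioo_mem_nhdsGT hLR
  have ctR : ∀ f : ℝ → ℝ, ContinuousOn f (Set.Icc qL qR) →
      Filter.Tendsto f (nhdsWithin qR (Set.Iio qR)) (nhds (f qR)) := by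
    intro f hf
    have h1 := hf qR ⟨hLR.le, le_rfl⟩
    refine h1.mono_left ?_
    rw [← nhdsWithin_Ioo_eq_nhdsLT hLR]
    exact nhdsWithin_mono _ Set.Ioo_subset_Icc_self
  have ctL : ∀ f : ℝ → ℝ, ContinuousOn f (Set.Icc qL qR) →
      Filter.Tendsto f (nhdsWithin qL (Set.Ioi qL)) (nhds (f qL)) := by
    intro f hf
    have h1 := hf qL ⟨le_rfl, hLR.le⟩
    refine h1.mono_left ?_
    rw [← nhdsWithin_Ioo_eq_nhdsGT hLR]
    exact nhdsWithin_mono _ Set.Ioo_subset_Icc_self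
  have limR : Filter.Tendsto χ (nhdsWithin qR (Set.Iio qR)) (nhds (π / 2)) := by
    obtain ⟨h1, h2⟩ := wi_lim k c (V qR) hc0 _ H V (hHR ▸ ctR H hHc)
      (evR.mono fun q hq => hH1 q hq) (ctR V hVc)
    have h3 := h1.pos_mul_atTop hVR h2
    exact (Real.tendsto_arctan_atTop.mono_right nhdsWithin_le_nhds).comp h3
  have limL : Filter.Tendsto χ (nhdsWithin qL (Set.Ioi qL)) (nhds (-(π / 2))) := by
    obtain ⟨h1, h2⟩ := wi_lim k c (V qL) hc0 _ H V (hHL ▸ ctL H hHc)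
      (evL.mono fun q hq => hH1 q hq) (ctL V hVc)
    have h3 := h1.neg_mul_atTop hVL h2
    exact (Real.tendsto_arctan_atBot.mono_right nhdsWithin_le_nhds).comp h3
  have step1 : ∀ a ∈ Set.Ioo qL qR, ENNReal.ofReal ((π / 2 - χ a) / c) ≤ I := by
    intro a ha
    refine le_of_tendsto (ENNReal.tendsto_ofReal ((limR.sub_const (χ a)).div_const c)) ?_
    filter_upwards [Ioo_mem_nhdsLT ha.2] with b hb
    exact hmain a ha b ⟨ha.1.trans hb.1, hb.2⟩ hb.1.le
  have step2 : ENNReal.ofReal ((π / 2 - (-(π / 2))) / c) ≤ I := by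
    refine le_of_tendsto (ENNReal.tendsto_ofReal ((limL.const_sub (π / 2)).div_const c)) ?_
    filter_upwards [evL] with a ha using step1 a ha
  rwa [show π / 2 - (-(π / 2)) = π by ring] at step2

lemma wi_inner (k α b q0 x q1 : ℝ) (hk : 0 < k) (hk1 : k < 1) (hα : 0 < α) (hb : 0 < b)
    (hq0 : 0 < q0) (h0x : q0 < x) (hx1 : x < q1)
    (h0 : q0 ^ k < α * q0 + b) (hx : α * x + b < x ^ k) (h1 : q1 ^ k < α * q1 + b) :
    ENNReal.ofReal (π / √(k * (1 - k))) ≤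
      ∫⁻ q in Set.Ioo q0 q1, ENNReal.ofReal ((α * q + b) / √(q ^ (2 * k) - (α * q + b) ^ 2) / q) := by
  have hfc : ∀ a c, ContinuousOn (fun q : ℝ => q ^ k - (α * q + b)) (Set.Icc a c) := fun a c =>
    ((continuous_id.rpow_const (fun _ => Or.inr hk.le)).sub (by fun_prop)).continuousOn
  obtain ⟨qL, ⟨hL0, hLx⟩, hfL⟩ := intermediate_value_Ioo h0x.le (hfc q0 x)
    (show (0:ℝ) ∈ Set.Ioo _ _ from ⟨by linarith, by linarith⟩)
  obtain ⟨qR, ⟨hxR, hR1⟩, hfR⟩ := intermediate_value_Ioo' hx1.le (hfc x q1)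
    (show (0:ℝ) ∈ Set.Ioo _ _ from ⟨by linarith, by linarith⟩)
  simp only at hfL hfR
  have hqL : 0 < qL := hq0.trans hL0
  have hLR : qL < qR := hLx.trans hxR
  have hqR : 0 < qR := hqL.trans hLR
  let H : ℝ → ℝ := fun q => (α * q + b) * q ^ (-k)
  let V : ℝ → ℝ := fun q => (α * (1 - k) * q - k * b) * q ^ (-k)
  have hone : ∀ q : ℝ, 0 < q → q ^ k * q ^ (-k) = 1 := fun q hq => by
    rw [← Real.rpow_add hq]; simp
  have hr : ∀ q : ℝ, 0 < q → HasDerivAt (fun q : ℝ => q ^ (-k)) (-k * q ^ (-k) / q) q := by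
    intro q hq
    have := Real.hasDerivAt_rpow_const (x := q) (p := -k) (Or.inl hq.ne')
    rw [Real.rpow_sub_one hq.ne'] at this
    refine this.congr_deriv ?_
    ring
  have hdH : ∀ q : ℝ, 0 < q → HasDerivAt H (V q / q) q := by
    intro q hq
    refine ((((hasDerivAt_id q).const_mul α).add_const b).fun_mul (hr q hq)).congr_deriv ?_
    simp only [V, id]
    field_simp; ring
  have hdV : ∀ q : ℝ, 0 < q → HasDerivAt V ((k * (1 - k) * H q + (1 - 2 * k) * V q) / q) q := by
    intro q hq
    refine ((((hasDerivAt_id q).const_mul (α * (1 - k))).sub_const (k * b)).fun_mul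
      (hr q hq)).congr_deriv ?_
    simp only [V, H, id]
    field_simp; ring
  have hHL : H qL = 1 := by
    simp only [H]; rw [← hone qL hqL]; congr 1; linarith
  have hHR : H qR = 1 := by
    simp only [H]; rw [← hone qR hqR]; congr 1; linarith
  have hpos : ∀ q ∈ Set.Icc qL qR, 0 < q := fun q hq => hqL.trans_le hq.1
  have hHc : ContinuousOn H (Set.Icc qL qR) := fun q hq =>
    (hdH q (hpos q hq)).continuousAt.continuousWithinAt
  have hVc : ContinuousOn V (Set.Icc qL qR) := fun q hq =>
    (hdV q (hpos q hq)).continuousAt.continuousWithinAt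
  obtain ⟨ξ, hξ, hξ0⟩ := exists_hasDerivAt_eq_zero hLR hHc (hHL.trans hHR.symm)
    (fun q hq => hdH q (hpos q (Set.Ioo_subset_Icc_self hq)))
  have hξp := hpos ξ (Set.Ioo_subset_Icc_self hξ)
  have hξ1 : α * (1 - k) * ξ - k * b = 0 := by
    rw [div_eq_zero_iff, or_iff_left hξp.ne'] at hξ0
    simp only [V] at hξ0
    rcases mul_eq_zero.1 hξ0 with h | h
    · exact h
    · exact absurd h (Real.rpow_pos_of_pos hξp _).ne'
  have hα1 : 0 < α * (1 - k) := mul_pos hα (by linarith)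
  have hVL : V qL < 0 := by
    refine mul_neg_of_neg_of_pos ?_ (Real.rpow_pos_of_pos hqL _)
    nlinarith [hξ.1]
  have hVR : 0 < V qR := by
    refine mul_pos ?_ (Real.rpow_pos_of_pos hqR _)
    nlinarith [hξ.2]
  have hlt : ∀ q ∈ Set.Ioo qL qR, α * q + b < q ^ k := fun q hq =>
    wi_chord k hk hk1 α b qL qR q hqL hq.1 hq.2 (by linarith) (by linarith)
  have hH1 : ∀ q ∈ Set.Ioo qL qR, 0 < H q ∧ H q < 1 := by
    intro q hq
    have hq0 := hpos q (Set.Ioo_subset_Icc_self hq)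
    have hrp := Real.rpow_pos_of_pos hq0 (-k)
    refine ⟨by simp only [H]; positivity, ?_⟩
    rw [← hone q hq0]
    exact mul_lt_mul_of_pos_right (hlt q hq) hrp
  have key := wi_inner0 k qL qR hk hk1 hqL hLR H V hHc hVc hH1
    (fun q hq => hdH q (hpos q (Set.Ioo_subset_Icc_self hq)))
    (fun q hq => hdV q (hpos q (Set.Ioo_subset_Icc_self hq))) hHL hHR hVL hVR
  refine key.trans ?_
  refine le_trans (le_of_eq ?_) (lintegral_mono_set (Set.Ioo_subset_Ioo hL0.le hR1.le))
  refine setLIntegral_congr_fun measurableSet_Ioo fun q hq => ?_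
  have hq0 := hpos q (Set.Ioo_subset_Icc_self hq)
  have hrp := Real.rpow_pos_of_pos hq0 (-k)
  have hkp := Real.rpow_pos_of_pos hq0 k
  have e1 : √(q ^ (2 * k) - (α * q + b) ^ 2) = q ^ k * √(1 - H q ^ 2) := by
    have : q ^ (2 * k) - (α * q + b) ^ 2 = (q ^ k) ^ 2 * (1 - H q ^ 2) := by
      rw [mul_comm 2 k, Real.rpow_mul hq0.le, Real.rpow_two]
      simp only [H]
      have := hone q hq0
      linear_combination (α * q + b)^2 * (q ^ k * q ^ (-k) + 1) * this
    rw [this, Real.sqrt_mul (by positivity), Real.sqrt_sq hkp.le]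
  rw [e1]
  congr 2
  simp only [H]
  have e2 : q ^ (-k) = (q ^ k)⁻¹ := Real.rpow_neg hq0.le k
  rw [e2, div_mul_eq_div_div, div_eq_mul_inv (α * q + b) (q ^ k)]

lemma wi_sqrt_int (m β B a : ℝ) (ha : 0 < a) (hm : 0 < m + β) (hBa : m + B ≤ a) (hβB : β ≤ B) :
    ∫⁻ b in Set.Ioo β B, ENNReal.ofReal ((m + b) / √(a ^ 2 - (m + b) ^ 2)) ≤
      ENNReal.ofReal (√(a ^ 2 - (m + β) ^ 2)) := by
  let F : ℝ → ℝ := fun b => -√(a ^ 2 - (m + b) ^ 2)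
  have hFc : ContinuousOn F (Set.Icc β B) := by
    apply Continuous.continuousOn
    fun_prop
  have hd : ∀ b ∈ Set.Ioo β B, HasDerivAt F ((m + b) / √(a ^ 2 - (m + b) ^ 2)) b := by
    intro b hb
    have h1 : HasDerivAt (fun b => a ^ 2 - (m + b) ^ 2) (-(2 * (m + b))) b := by
      refine ((((hasDerivAt_id b).const_add m).fun_pow 2).const_sub (a ^ 2)).congr_deriv ?_
      simp
    have h2 : 0 < a ^ 2 - (m + b) ^ 2 := by nlinarith [hb.1, hb.2]
    refine (h1.sqrt h2.ne').neg.congr_deriv ?_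
    field_simp
  have hnn : ∀ b ∈ Set.Ioo β B, 0 ≤ (m + b) / √(a ^ 2 - (m + b) ^ 2) := fun b hb =>
    div_nonneg (by linarith [hb.1]) (Real.sqrt_nonneg _)
  have hIntg := intervalIntegral.integrableOn_deriv_of_nonneg hFc hd hnn
  have heq := intervalIntegral.integral_eq_sub_of_hasDeriv_right_of_le hβB hFc
    (fun b hb => (hd b hb).hasDerivWithinAt)
    ((intervalIntegrable_iff_integrableOn_Ioc_of_le hβB).2 hIntg)
  have hIntg2 := hIntg.mono_set (Set.Ioo_subset_Ioc_self)
  rw [← ofReal_integral_eq_lintegral_ofReal hIntg2]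
  · apply ENNReal.ofReal_le_ofReal
    rw [← integral_Ioc_eq_integral_Ioo, ← intervalIntegral.integral_of_le hβB, heq]
    simp only [F]
    linarith [Real.sqrt_nonneg (a ^ 2 - (m + B) ^ 2)]
  · filter_upwards [ae_restrict_mem measurableSet_Ioo] with b hb using hnn b hb

lemma wi_phi (k α β q0 x q1 : ℝ) (hk : 0 < k) (hk1 : k < 1) (hα : 0 < α) (hβ : 0 < β)
    (hq0 : 0 < q0) (h0x : q0 < x) (hx1 : x < q1)
    (h0 : α * q0 + β = q0 ^ k) (h1 : α * q1 + β = q1 ^ k) :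
    ENNReal.ofReal (π / √(k * (1 - k)) * (x ^ k - α * x - β)) ≤
      ∫⁻ q in Set.Ioo q0 q1, ENNReal.ofReal (√(q ^ (2 * k) - (α * q + β) ^ 2) / q) := by
  have hxk := wi_chord k hk hk1 α β q0 q1 x hq0 h0x hx1 h0 h1
  set δ := x ^ k - α * x - β with hδ
  let F : ℝ → ℝ → ENNReal := fun b q =>
    ENNReal.ofReal ((α * q + b) / √(q ^ (2 * k) - (α * q + b) ^ 2) / q)
  have hFm : Measurable (Function.uncurry F) := by
    simp only [F, Function.uncurry_def]
    fun_prop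
  calc ENNReal.ofReal (π / √(k * (1 - k)) * δ)
      = ∫⁻ b in Set.Ioo β (β + δ), ENNReal.ofReal (π / √(k * (1 - k))) := by
        rw [setLIntegral_const, Real.volume_Ioo, ENNReal.ofReal_mul (by positivity)]
        congr 2; ring
    _ ≤ ∫⁻ b in Set.Ioo β (β + δ), ∫⁻ q in Set.Ioo q0 q1, F b q := by
        refine setLIntegral_mono' measurableSet_Ioo fun b hb => ?_
        exact wi_inner k α b q0 x q1 hk hk1 hα (hβ.trans hb.1) hq0 h0x hx1
          (by linarith [hb.1]) (by linarith [hb.2]) (by linarith [hb.1])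
    _ = ∫⁻ q in Set.Ioo q0 q1, ∫⁻ b in Set.Ioo β (β + δ), F b q :=
        lintegral_lintegral_swap hFm.aemeasurable
    _ ≤ _ := by
        refine setLIntegral_mono' measurableSet_Ioo fun q hq => ?_
        have hq0' : 0 < q := hq0.trans hq.1
        have hqk := wi_chord k hk hk1 α β q0 q1 q hq0 hq.1 hq.2 h0 h1
        have hkp := Real.rpow_pos_of_pos hq0' k
        have hsq : q ^ (2 * k) = (q ^ k) ^ 2 := by
          rw [mul_comm 2 k, Real.rpow_mul hq0'.le, Real.rpow_two]
        have key := wi_sqrt_int (α * q) β (q ^ k - α * q) (q ^ k) hkp (by positivity) (by linarith)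
          (by linarith)
        calc ∫⁻ b in Set.Ioo β (β + δ), F b q ≤ ∫⁻ b in Set.Ioo β (q ^ k - α * q), F b q := by
              rw [← lintegral_indicator measurableSet_Ioo, ← lintegral_indicator measurableSet_Ioo]
              refine lintegral_mono fun b => ?_
              by_cases hb : b ∈ Set.Ioo β (β + δ)
              · by_cases hb2 : b < q ^ k - α * q
                · rw [Set.indicator_of_mem hb, Set.indicator_of_mem (show b ∈ Set.Ioo β (q ^ k - α * q) from ⟨hb.1, hb2⟩)]
                · have : F b q = 0 := by
                    simp only [F]
                    rw [Real.sqrt_eq_zero_of_nonpos]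
                    · simp
                    · rw [hsq]; nlinarith
                  rw [Set.indicator_of_mem hb, this]
                  exact zero_le
              · rw [Set.indicator_of_notMem hb]; exact zero_le
          _ = ∫⁻ b in Set.Ioo β (q ^ k - α * q), ENNReal.ofReal (1 / q) *
                ENNReal.ofReal ((α * q + b) / √((q ^ k) ^ 2 - (α * q + b) ^ 2)) := by
              refine lintegral_congr fun b => ?_
              simp only [F]
              rw [← ENNReal.ofReal_mul (by positivity), hsq]
              congr 1; ring
          _ = ENNReal.ofReal (1 / q) * ∫⁻ b in Set.Ioo β (q ^ k - α * q),
                ENNReal.ofReal ((α * q + b) / √((q ^ k) ^ 2 - (α * q + b) ^ 2)) := by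
              rw [lintegral_const_mul]; fun_prop
          _ ≤ ENNReal.ofReal (1 / q) * ENNReal.ofReal (√((q ^ k) ^ 2 - (α * q + β) ^ 2)) := by gcongr
          _ = _ := by
              rw [← ENNReal.ofReal_mul (by positivity), hsq]
              congr 1; ring

lemma wi_pre_front {α : Type*} [TopologicalSpace α] {S A : Set α} (hS : IsPreconnected S)
    (h1 : (S ∩ A).Nonempty) (h2 : (S ∩ Aᶜ).Nonempty) : (S ∩ frontier A).Nonempty := by
  by_contra hne
  have hd : ∀ x ∈ S, x ∉ frontier A := fun x hx hf => hne ⟨x, hx, hf⟩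
  have hA : ∀ x ∈ S, x ∈ A → x ∈ interior A := fun x hx hxA => by
    by_contra hi
    exact hd x hx ⟨subset_closure hxA, hi⟩
  have hA' : ∀ x ∈ S, x ∉ A → x ∈ (closure A)ᶜ := fun x hx hxA hc => by
    exact hd x hx ⟨hc, fun hi => hxA (interior_subset hi)⟩
  obtain ⟨x, hx, hxA⟩ := h1
  obtain ⟨y, hy, hyA⟩ := h2
  obtain ⟨z, _, hz1, hz2⟩ := hS (interior A) (closure A)ᶜ isOpen_interior isClosed_closure.isOpen_compl
    (fun w hw => by
      by_cases hwA : w ∈ A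
      · exact Or.inl (hA w hw hwA)
      · exact Or.inr (hA' w hw hwA)) ⟨x, hx, hA x hx hxA⟩ ⟨y, hy, hA' y hy hyA⟩
  exact hz2 (subset_closure (interior_subset hz1))

lemma wi_ray_front (Ω : Set (EuclideanSpace ℝ (Fin 2))) (hb : Bornology.IsBounded Ω)
    (w : EuclideanSpace ℝ (Fin 2)) (hw : w ∈ closure Ω) (hw0 : w ≠ 0) :
    ∃ μ : ℝ, 1 ≤ μ ∧ μ • w ∈ frontier Ω := by
  by_cases hwΩ : w ∈ Ω
  · have hpre : IsPreconnected ((fun μ : ℝ => μ • w) '' Set.Ici 1) :=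
      isPreconnected_Ici.image _ (by fun_prop)
    obtain ⟨R, hR⟩ := hb.subset_closedBall 0
    have hw1 : 0 < ‖w‖ := norm_pos_iff.2 hw0
    have h2 : ((fun μ : ℝ => μ • w) '' Set.Ici 1 ∩ Ω).Nonempty :=
      ⟨w, ⟨1, Set.mem_Ici.2 le_rfl, by simp⟩, hwΩ⟩
    have h3 : ((fun μ : ℝ => μ • w) '' Set.Ici 1 ∩ Ωᶜ).Nonempty := by
      refine ⟨(max 1 ((R + 1) / ‖w‖)) • w, ⟨_, Set.mem_Ici.2 (le_max_left _ _), rfl⟩, fun hmem => ?_⟩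
      have h4 := hR hmem
      rw [mem_closedBall, dist_zero_right, norm_smul, Real.norm_of_nonneg
        (le_trans zero_le_one (le_max_left _ _))] at h4
      have h5 : (R + 1) / ‖w‖ * ‖w‖ ≤ max 1 ((R + 1) / ‖w‖) * ‖w‖ := by
        gcongr; exact le_max_right _ _
      rw [div_mul_cancel₀ _ hw1.ne'] at h5
      linarith
    obtain ⟨z, ⟨μ, hμ, rfl⟩, hz⟩ := wi_pre_front hpre h2 h3
    exact ⟨μ, hμ, hz⟩
  · refine ⟨1, le_rfl, ?_⟩
    rw [one_smul, frontier_eq_closure_inter_closure]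
    exact ⟨hw, subset_closure hwΩ⟩

lemma wi_normsq (z : EuclideanSpace ℝ (Fin 2)) : ‖z‖ ^ 2 = z 0 ^ 2 + z 1 ^ 2 := by
  rw [wi_norm, Real.sq_sqrt (by positivity)]

section
variable {E : Set ℝ} {X Y X' Y' : ℝ → ℝ}

lemma wi_ray {Ω : Set (EuclideanSpace ℝ (Fin 2))} (hb : Bornology.IsBounded Ω)
    (h : WiPar (frontier Ω) E X Y X' Y') (r0 : ℝ) (hr0 : 0 < r0) (hr : sphere 0 r0 ⊆ closure Ω)
    (w : EuclideanSpace ℝ (Fin 2)) (hw : w ∈ closure Ω ∨ ‖w‖ ≤ r0) :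
    ∃ s ∈ E ∩ {s | r0 ^ 2 ≤ X s ^ 2 + Y s ^ 2}, ∃ l ∈ Set.Icc (0:ℝ) 1, w 0 = l * X s ∧ w 1 = l * Y s := by
  have main : ∀ w : EuclideanSpace ℝ (Fin 2), w ≠ 0 → (w ∈ closure Ω ∨ ‖w‖ ≤ r0) →
      ∃ s ∈ E ∩ {s | r0 ^ 2 ≤ X s ^ 2 + Y s ^ 2}, ∃ l ∈ Set.Icc (0:ℝ) 1,
        w 0 = l * X s ∧ w 1 = l * Y s := by
    intro w hw0 hw
    have hw1 : 0 < ‖w‖ := norm_pos_iff.2 hw0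
    have step : ∃ μ : ℝ, 1 ≤ μ ∧ μ • w ∈ closure Ω ∧ r0 ≤ ‖μ • w‖ := by
      rcases le_total ‖w‖ r0 with hle | hle
      · refine ⟨r0 / ‖w‖, (one_le_div hw1).2 hle, hr ?_, ?_⟩
        · rw [mem_sphere, dist_zero_right, norm_smul, Real.norm_of_nonneg (by positivity),
            div_mul_cancel₀ _ hw1.ne']
        · rw [norm_smul, Real.norm_of_nonneg (by positivity), div_mul_cancel₀ _ hw1.ne']
      · rcases hw with hw | hw
        · exact ⟨1, le_rfl, by simpa using hw, by simpa using hle⟩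
        · refine ⟨1, le_rfl, ?_, by simpa using hle⟩
          rw [one_smul]
          exact hr (by rw [mem_sphere, dist_zero_right]; exact le_antisymm hw hle)
    obtain ⟨μ, hμ, h1, h2⟩ := step
    have hμ0 : (0:ℝ) < μ := by linarith
    obtain ⟨μ', hμ', h3⟩ := wi_ray_front Ω hb (μ • w) h1 (smul_ne_zero hμ0.ne' hw0)
    have hμ'0 : (0:ℝ) < μ' := by linarith
    obtain ⟨s, hs, hx, hy⟩ := h.surj _ h3
    have hge : r0 ≤ ‖μ' • μ • w‖ := by
      rw [norm_smul, Real.norm_of_nonneg hμ'0.le]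
      nlinarith
    refine ⟨s, ⟨hs, ?_⟩, (μ' * μ)⁻¹, ⟨by positivity, inv_le_one_of_one_le₀ (by nlinarith)⟩, ?_, ?_⟩
    · show r0 ^ 2 ≤ _
      rw [hx, hy, ← wi_normsq]
      gcongr
    · rw [hx]; simp only [PiLp.smul_apply, smul_eq_mul]; field_simp
    · rw [hy]; simp only [PiLp.smul_apply, smul_eq_mul]; field_simp
  by_cases hw0 : w = 0
  · have hne : (!₂[r0, 0] : EuclideanSpace ℝ (Fin 2)) ≠ 0 := by
      intro h0
      have := congrArg (fun z => z 0) h0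
      simp at this
      exact hr0.ne' this
    obtain ⟨s, hs, -⟩ := main !₂[r0, 0] hne (Or.inr (by
      rw [wi_norm]; simp [Real.sqrt_sq hr0.le]))
    exact ⟨s, hs, 0, ⟨le_rfl, zero_le_one⟩, by simp [hw0], by simp [hw0]⟩
  · exact main w hw0 hw

lemma wi_measE' {K : Set (EuclideanSpace ℝ (Fin 2))} (h : WiPar K E X Y X' Y') (r0 : ℝ) :
    MeasurableSet (E ∩ {s | r0 ^ 2 ≤ X s ^ 2 + Y s ^ 2}) := by
  have := h.mX; have := h.mY
  exact h.measE.inter (measurableSet_le measurable_const (by fun_prop))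

lemma wi_area {Ω : Set (EuclideanSpace ℝ (Fin 2))} (hb : Bornology.IsBounded Ω)
    (h : WiPar (frontier Ω) E X Y X' Y') (r0 : ℝ) (hr0 : 0 < r0) (hr : sphere 0 r0 ⊆ closure Ω) :
    volume Ω ≤ ∫⁻ s in E ∩ {s | r0 ^ 2 ≤ X s ^ 2 + Y s ^ 2},
      ENNReal.ofReal (|X s * Y' s - Y s * X' s| / 2) := by
  have := wi_radial h (E ∩ {s | r0 ^ 2 ≤ X s ^ 2 + Y s ^ 2}) (wi_measE' h r0) Set.inter_subset_left
    (fun _ => 0) (fun _ => 1) measurable_const measurable_const (fun _ _ => le_rfl)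
    (fun _ _ => zero_le_one) Ω (fun w hw => wi_ray hb h r0 hr0 hr w (Or.inl (subset_closure hw)))
  refine this.trans (le_of_eq (lintegral_congr fun s => ?_))
  congr 1; ring

lemma wi_vol_ball (r : ℝ) (hr : 0 ≤ r) :
    volume (ball (0 : EuclideanSpace ℝ (Fin 2)) r) = ENNReal.ofReal (π * r ^ 2) := by
  rw [EuclideanSpace.volume_ball_fin_two, mul_comm π, ENNReal.ofReal_mul (by positivity),
    ENNReal.ofReal_pow hr]

lemma wi_ballbd {Ω : Set (EuclideanSpace ℝ (Fin 2))} (hb : Bornology.IsBounded Ω)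
    (h : WiPar (frontier Ω) E X Y X' Y') (r0 : ℝ) (hr0 : 0 < r0) (hr : sphere 0 r0 ⊆ closure Ω) :
    ENNReal.ofReal π ≤ ∫⁻ s in E ∩ {s | r0 ^ 2 ≤ X s ^ 2 + Y s ^ 2},
      ENNReal.ofReal (|X s * Y' s - Y s * X' s| / (X s ^ 2 + Y s ^ 2) / 2) := by
  have hm1 := h.mX; have hm2 := h.mY; have hm3 := h.mX'; have hm4 := h.mY'
  have := wi_radial h (E ∩ {s | r0 ^ 2 ≤ X s ^ 2 + Y s ^ 2}) (wi_measE' h r0) Set.inter_subset_left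
    (fun _ => 0) (fun s => r0 / √(X s ^ 2 + Y s ^ 2)) measurable_const (by fun_prop) (fun _ _ => le_rfl)
    (fun _ _ => by positivity) (ball 0 r0) (fun w hw => by
      rw [mem_ball, dist_zero_right] at hw
      obtain ⟨s, hs, l, hl, h1, h2⟩ := wi_ray hb h r0 hr0 hr w (Or.inr hw.le)
      refine ⟨s, hs, l, ⟨hl.1, ?_⟩, h1, h2⟩
      have hq : 0 < X s ^ 2 + Y s ^ 2 := lt_of_lt_of_le (by positivity) hs.2
      rw [le_div_iff₀ (Real.sqrt_pos.2 hq)]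
      refine le_trans (le_of_eq ?_) hw.le
      rw [wi_norm, h1, h2, show (l * X s) ^ 2 + (l * Y s) ^ 2 = l ^ 2 * (X s ^ 2 + Y s ^ 2) by ring,
        Real.sqrt_mul (by positivity), Real.sqrt_sq hl.1])
  rw [wi_vol_ball r0 hr0.le] at this
  have e : ∫⁻ s in E ∩ {s | r0 ^ 2 ≤ X s ^ 2 + Y s ^ 2}, ENNReal.ofReal (|X s * Y' s - Y s * X' s| *
      (((r0 / √(X s ^ 2 + Y s ^ 2)) ^ 2 - 0 ^ 2) / 2)) =
      ENNReal.ofReal (r0 ^ 2) * ∫⁻ s in E ∩ {s | r0 ^ 2 ≤ X s ^ 2 + Y s ^ 2},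
      ENNReal.ofReal (|X s * Y' s - Y s * X' s| / (X s ^ 2 + Y s ^ 2) / 2) := by
    rw [← lintegral_const_mul _ (by fun_prop)]
    refine lintegral_congr fun s => ?_
    rw [← ENNReal.ofReal_mul (by positivity), div_pow, Real.sq_sqrt (by positivity)]
    congr 1; ring
  rw [e, mul_comm π, ENNReal.ofReal_mul (by positivity)] at this
  exact (ENNReal.mul_le_mul_iff_right (by simpa using hr0.ne') ENNReal.ofReal_ne_top).1 this

lemma wi_annulus {Ω : Set (EuclideanSpace ℝ (Fin 2))} (hb : Bornology.IsBounded Ω)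
    (h : WiPar (frontier Ω) E X Y X' Y') (r0 : ℝ) (hr0 : 0 < r0) (hr : sphere 0 r0 ⊆ closure Ω)
    (ρ : ℝ) (hρ : 0 ≤ ρ) :
    volume Ω ≤ ENNReal.ofReal (π * ρ ^ 2) + ∫⁻ s in E,
      ENNReal.ofReal (|X s * Y' s - Y s * X' s| * max 0 (1 - ρ ^ 2 / (X s ^ 2 + Y s ^ 2)) / 2) := by
  have hm1 := h.mX; have hm2 := h.mY; have hm3 := h.mX'; have hm4 := h.mY'
  have h1 : volume Ω ≤ volume (ball (0 : EuclideanSpace ℝ (Fin 2)) ρ) + volume (Ω \ ball 0 ρ) := by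
    refine (measure_mono ?_).trans (measure_union_le _ _)
    rw [Set.union_sdiff_self]; exact Set.subset_union_right
  rw [wi_vol_ball ρ hρ] at h1
  refine h1.trans (add_le_add le_rfl ?_)
  have := wi_radial h (E ∩ {s | r0 ^ 2 ≤ X s ^ 2 + Y s ^ 2}) (wi_measE' h r0) Set.inter_subset_left
    (fun s => min (ρ / √(X s ^ 2 + Y s ^ 2)) 1) (fun _ => 1) (by fun_prop) measurable_const
    (fun _ _ => by positivity)
    (fun _ _ => min_le_right _ _) (Ω \ ball 0 ρ) (fun w hw => by
      obtain ⟨s, hs, l, hl, h1, h2⟩ := wi_ray hb h r0 hr0 hr w (Or.inl (subset_closure hw.1))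
      refine ⟨s, hs, l, ⟨(min_le_left _ _).trans ?_, hl.2⟩, h1, h2⟩
      have hq : 0 < X s ^ 2 + Y s ^ 2 := lt_of_lt_of_le (by positivity) hs.2
      rw [div_le_iff₀ (Real.sqrt_pos.2 hq)]
      have h3 := hw.2
      rw [mem_ball, dist_zero_right, not_lt] at h3
      refine h3.trans (le_of_eq ?_)
      rw [wi_norm, h1, h2, show (l * X s) ^ 2 + (l * Y s) ^ 2 = l ^ 2 * (X s ^ 2 + Y s ^ 2) by ring,
        Real.sqrt_mul (by positivity), Real.sqrt_sq hl.1])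
  refine this.trans ((lintegral_mono_set Set.inter_subset_left).trans ?_)
  refine lintegral_mono fun s => ENNReal.ofReal_le_ofReal ?_
  rw [mul_div_assoc]
  gcongr
  set t := ρ / √(X s ^ 2 + Y s ^ 2) with ht
  have ht0 : 0 ≤ t := by positivity
  have e : ρ ^ 2 / (X s ^ 2 + Y s ^ 2) = t ^ 2 := by
    rw [ht, div_pow, Real.sq_sqrt (by positivity)]
  rw [e]
  rcases le_total t 1 with h5 | h5
  · rw [min_eq_left h5, one_pow]; exact le_max_right _ _
  · rw [min_eq_right h5]; simp
end

lemma wi_ball_center {Ω : Set (EuclideanSpace ℝ (Fin 2))} (ho : IsOpen Ω)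
    (hc : IsConnected Ω) (h0 : (0 : EuclideanSpace ℝ (Fin 2)) ∈ Ω) (r : ℝ) (hr : 0 < r)
    (h1 : ∀ z ∈ frontier Ω, r ≤ ‖z‖) (h2 : sphere 0 r ⊆ frontier Ω) : Ω = ball 0 r := by
  apply Set.Subset.antisymm
  · intro w hw
    rw [mem_ball_zero_iff]
    by_contra hlt
    push Not at hlt
    have hpre := hc.isPreconnected.image norm continuous_norm.continuousOn
    have := hpre.Icc_subset ⟨0, h0, norm_zero⟩ ⟨w, hw, rfl⟩ ⟨hr.le, hlt⟩
    obtain ⟨z, hz, hzr⟩ := this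
    have h3 := h2 (mem_sphere_zero_iff_norm.2 hzr)
    rw [ho.frontier_eq] at h3
    exact h3.2 hz
  · intro w hw
    by_contra hn
    obtain ⟨z, hz, hzf⟩ := wi_pre_front (convex_ball (0 : EuclideanSpace ℝ (Fin 2)) r).isPreconnected
      (A := Ω) ⟨0, by simpa using hr, h0⟩ ⟨w, hw, hn⟩
    have := h1 z hzf
    rw [mem_ball_zero_iff] at hz
    linarith

lemma wi_ball_general {Ω : Set (EuclideanSpace ℝ (Fin 2))} (ho : IsOpen Ω)
    (hb : Bornology.IsBounded Ω)
    (hn : Ω.Nonempty) (c : EuclideanSpace ℝ (Fin 2)) (r : ℝ) (hr : 0 < r)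
    (h1 : frontier Ω ⊆ sphere c r) : Ω = ball c r := by
  have hsub : Ω ⊆ closedBall c r := by
    intro w hw
    rw [mem_closedBall]
    by_contra hlt
    push Not at hlt
    obtain ⟨R, hR⟩ := hb.subset_closedBall c
    have hw0 : 0 < dist w c := hr.trans hlt
    have hpre : IsPreconnected ((fun μ : ℝ => c + μ • (w - c)) '' Set.Ici 1) :=
      isPreconnected_Ici.image _ (by fun_prop)
    have hd : ∀ μ : ℝ, 1 ≤ μ → dist (c + μ • (w - c)) c = μ * dist w c := fun μ hμ => by
      rw [dist_eq_norm, add_sub_cancel_left, norm_smul, Real.norm_of_nonneg (by linarith), ← dist_eq_norm]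
    obtain ⟨z, ⟨μ, hμ, rfl⟩, hz⟩ := wi_pre_front hpre (A := Ω)
      ⟨w, ⟨1, Set.mem_Ici.2 le_rfl, by simp⟩, hw⟩
      ⟨_, ⟨max 1 ((R + 1) / dist w c), Set.mem_Ici.2 (le_max_left _ _), rfl⟩, fun hmem => by
        have h4 := hR hmem
        rw [mem_closedBall, hd _ (le_max_left _ _)] at h4
        have h5 : (R + 1) / dist w c * dist w c ≤ max 1 ((R + 1) / dist w c) * dist w c := by
          gcongr; exact le_max_right _ _
        rw [div_mul_cancel₀ _ hw0.ne'] at h5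
        linarith⟩
    have h6 := h1 hz
    rw [mem_sphere, hd μ hμ] at h6
    have : 1 ≤ μ := hμ
    nlinarith
  have hsub' : Ω ⊆ ball c r := by
    rw [← interior_closedBall c hr.ne']
    exact interior_maximal hsub ho
  refine hsub'.antisymm fun w hw => ?_
  by_contra hnw
  obtain ⟨v, hv⟩ := hn
  obtain ⟨z, hz, hzf⟩ := wi_pre_front (convex_ball c r).isPreconnected
      (A := Ω) ⟨v, hsub' hv, hv⟩ ⟨w, hw, hnw⟩
  have := h1 hzf
  rw [mem_sphere] at this
  rw [mem_ball] at hz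
  linarith

lemma wi_ext {z w : EuclideanSpace ℝ (Fin 2)} (h0 : z 0 = w 0) (h1 : z 1 = w 1) : z = w := by
  ext i; fin_cases i
  · exact h0
  · exact h1

lemma wi_curve_sphere (γ : ℝ → EuclideanSpace ℝ (Fin 2)) (hγ : ContDiff ℝ 2 γ)
    (hp : Function.Periodic γ 1) (hd : ∀ t, deriv γ t ≠ 0) (Q : ℝ)
    (hn : ∀ t, γ t 0 ^ 2 + γ t 1 ^ 2 = Q) (c : EuclideanSpace ℝ (Fin 2))
    (hcQ : c 0 ^ 2 + c 1 ^ 2 = Q) : c ∈ Set.range γ := by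
  by_contra hcn
  have hdiff : Differentiable ℝ γ := hγ.differentiable (by norm_num)
  have hD : ∀ j t, HasDerivAt (fun t => γ t j) (deriv γ t j) t := fun j t =>
    (EuclideanSpace.proj (𝕜 := ℝ) j).hasFDerivAt.comp_hasDerivAt t (hdiff t).hasDerivAt
  have hcont : Continuous (fun t => γ t 0 * c 0 + γ t 1 * c 1) := by
    have := hγ.continuous; fun_prop
  obtain ⟨t0, -, ht0⟩ := isCompact_Icc.exists_isMaxOn (Set.nonempty_Icc.2 (zero_le_one (α := ℝ)))
    hcont.continuousOn
  have hmax : ∀ t, γ t 0 * c 0 + γ t 1 * c 1 ≤ γ t0 0 * c 0 + γ t0 1 * c 1 := fun t => by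
    obtain ⟨y, hy, hyt⟩ := hp.exists_mem_Ico₀ one_pos t
    have := ht0 ⟨hy.1, hy.2.le⟩
    rw [hyt]; exact this
  have e1 : deriv γ t0 0 * c 0 + deriv γ t0 1 * c 1 = 0 :=
    IsLocalMax.hasDerivAt_eq_zero (Filter.Eventually.of_forall hmax)
      (((hD 0 t0).mul_const (c 0)).fun_add ((hD 1 t0).mul_const (c 1)))
  have e2 : deriv γ t0 0 * γ t0 0 + deriv γ t0 1 * γ t0 1 = 0 := by
    have h1 := ((hD 0 t0).fun_pow 2).fun_add ((hD 1 t0).fun_pow 2)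
    have h2 : HasDerivAt (fun t => γ t 0 ^ 2 + γ t 1 ^ 2) 0 t0 := by
      simp only [hn]; exact hasDerivAt_const t0 Q
    have := h1.unique h2
    norm_num at this
    linarith
  have hne : 0 < deriv γ t0 0 ^ 2 + deriv γ t0 1 ^ 2 := by
    by_contra hle
    apply hd t0
    have a1 := sq_nonneg (deriv γ t0 0)
    have a2 := sq_nonneg (deriv γ t0 1)
    apply wi_ext <;> simp <;> nlinarith
  have e3 : γ t0 0 * c 1 - γ t0 1 * c 0 = 0 := by
    have h1 : deriv γ t0 0 * (γ t0 0 * c 1 - γ t0 1 * c 0) = 0 := by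
      linear_combination c 1 * e2 - γ t0 1 * e1
    have h2 : deriv γ t0 1 * (γ t0 0 * c 1 - γ t0 1 * c 0) = 0 := by
      linear_combination (-c 0) * e2 + γ t0 0 * e1
    have h3 : (deriv γ t0 0 ^ 2 + deriv γ t0 1 ^ 2) * (γ t0 0 * c 1 - γ t0 1 * c 0) = 0 := by
      linear_combination deriv γ t0 0 * h1 + deriv γ t0 1 * h2
    exact (mul_eq_zero.1 h3).resolve_left hne.ne'
  have e4 : (γ t0 0 * c 0 + γ t0 1 * c 1 - Q) * (γ t0 0 * c 0 + γ t0 1 * c 1 + Q) = 0 := by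
    have := hn t0
    linear_combination (c 0 ^ 2 + c 1 ^ 2) * this + Q * hcQ - (γ t0 0 * c 1 - γ t0 1 * c 0) * e3
  rcases mul_eq_zero.1 e4 with e5 | e5
  · apply hcn
    refine ⟨t0, ?_⟩
    have := hn t0
    have e6 : (γ t0 0 - c 0) ^ 2 + (γ t0 1 - c 1) ^ 2 = 0 := by
      linear_combination this + hcQ - 2 * e5
    apply wi_ext
    · nlinarith [sq_nonneg (γ t0 0 - c 0), sq_nonneg (γ t0 1 - c 1)]
    · nlinarith [sq_nonneg (γ t0 0 - c 0), sq_nonneg (γ t0 1 - c 1)]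
  · apply hd 0
    have hall : ∀ t, γ t = -c := fun t => by
      have := hn t
      have h7 := hmax t
      have e6 : (γ t 0 + c 0) ^ 2 + (γ t 1 + c 1) ^ 2 ≤ 0 := by
        linarith
      apply wi_ext
      · simp only [PiLp.neg_apply]; nlinarith [sq_nonneg (γ t 0 + c 0), sq_nonneg (γ t 1 + c 1)]
      · simp only [PiLp.neg_apply]; nlinarith [sq_nonneg (γ t 0 + c 0), sq_nonneg (γ t 1 + c 1)]
    have : γ = fun _ => -c := funext hall
    rw [this]; simp

lemma wi_null_subsingleton {f : ℝ → ℝ} (hf : Continuous f) (h : volume (Set.range f) = 0) (s t : ℝ) :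
    f s = f t := by
  have hpre : IsPreconnected (Set.range f) := isPreconnected_range hf
  have key : ∀ s t, ¬ f s < f t := fun s t hst => by
    have := measure_mono (μ := volume) (hpre.Icc_subset ⟨s, rfl⟩ ⟨t, rfl⟩)
    rw [h, Real.volume_Icc] at this
    have := ENNReal.ofReal_eq_zero.1 (le_antisymm this zero_le)
    linarith
  exact le_antisymm (not_lt.1 (key t s)) (not_lt.1 (key s t))

lemma wi_twosphere {Ω : Set (EuclideanSpace ℝ (Fin 2))} (ho : IsOpen Ω) (r : ℝ)
    (w e : EuclideanSpace ℝ (Fin 2)) (hw : w ∈ Ω) (he : e ∉ closure Ω) (hr : 0 < r) (hwr : ‖w‖ = r)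
    (her : ‖e‖ = r) : ∃ z ∈ frontier Ω, ∃ z' ∈ frontier Ω, z ≠ z' ∧ ‖z‖ = r ∧ ‖z'‖ = r := by
  let P : ℝ → EuclideanSpace ℝ (Fin 2) := fun θ => !₂[r * cos θ, r * sin θ]
  have hPc : Continuous P := by
    refine (PiLp.continuous_toLp 2 _).comp (continuous_pi fun i => ?_)
    fin_cases i <;> simp <;> fun_prop
  have hPn : ∀ θ, ‖P θ‖ = r := fun θ => by
    rw [wi_norm]; simp only [P]; simp
    rw [Real.sqrt_eq_iff_mul_self_eq_of_pos hr]
    linear_combination (-r ^ 2) * sin_sq_add_cos_sq θ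
  have hang : ∀ z : EuclideanSpace ℝ (Fin 2), ‖z‖ = r → ∃ θ, -π < θ ∧ θ ≤ π ∧ P θ = z := fun z hz => by
    let y : ℂ := ⟨z 0, z 1⟩
    have hy : ‖y‖ = r := by
      rw [← hz, wi_norm, Complex.norm_eq_sqrt_sq_add_sq]
    refine ⟨y.arg, Complex.neg_pi_lt_arg y, Complex.arg_le_pi y, ?_⟩
    apply wi_ext
    · simp only [P]; simp; rw [← hy, Complex.norm_mul_cos_arg]
    · simp only [P]; simp; rw [← hy, Complex.norm_mul_sin_arg]
  obtain ⟨θ1, ha1, hb1, rfl⟩ := hang w hwr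
  have hP2 : ∀ θ, P (θ + 2 * π) = P θ := fun θ => by
    simp only [P, cos_add_two_pi, sin_add_two_pi]
  obtain ⟨θ2, h12, h21, rfl⟩ : ∃ θ2, θ1 < θ2 ∧ θ2 < θ1 + 2 * π ∧ P θ2 = e := by
    obtain ⟨θ2, ha2, hb2, hh⟩ := hang e her
    rcases lt_trichotomy θ1 θ2 with hlt | heq | hgt
    · exact ⟨θ2, hlt, by linarith, hh⟩
    · subst heq; subst hh; exact absurd (subset_closure hw) he
    · exact ⟨θ2 + 2 * π, by linarith [pi_pos], by linarith, by rw [hP2, hh]⟩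
  have hwn : P θ1 ∉ frontier Ω := by rw [ho.frontier_eq]; exact fun h => h.2 hw
  have hen : P θ2 ∉ frontier Ω := fun h => he h.1
  obtain ⟨z, ⟨t, ht, rfl⟩, hzf⟩ := wi_pre_front (A := Ω) (isPreconnected_Icc.image P hPc.continuousOn)
    ⟨_, ⟨θ1, ⟨le_rfl, h12.le⟩, rfl⟩, hw⟩ ⟨_, ⟨θ2, ⟨h12.le, le_rfl⟩, rfl⟩, fun h => he (subset_closure h)⟩
  obtain ⟨z, ⟨t', ht', rfl⟩, hzf'⟩ := wi_pre_front (A := Ω) (isPreconnected_Icc.image P hPc.continuousOn)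
    ⟨_, ⟨θ1 + 2 * π, ⟨h21.le, le_rfl⟩, rfl⟩, by rw [hP2]; exact hw⟩
    ⟨_, ⟨θ2, ⟨le_rfl, h21.le⟩, rfl⟩, fun h => he (subset_closure h)⟩
  refine ⟨_, hzf, _, hzf', fun heq => ?_, hPn _, hPn _⟩
  have hlt1 : t < θ2 := lt_of_le_of_ne ht.2 (by rintro rfl; exact hen hzf)
  have hlt2 : θ2 < t' := lt_of_le_of_ne ht'.1 (by rintro rfl; exact hen hzf')
  have hlt3 : θ1 < t := lt_of_le_of_ne ht.1 (by rintro rfl; exact hwn hzf)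
  have c1 : r * cos t = r * cos t' := congrArg (fun z : EuclideanSpace ℝ (Fin 2) => z 0) heq
  have c2 : r * sin t = r * sin t' := congrArg (fun z : EuclideanSpace ℝ (Fin 2) => z 1) heq
  have c1 := mul_left_cancel₀ hr.ne' c1
  have c2 := mul_left_cancel₀ hr.ne' c2
  have c3 : cos (t' - t) = 1 := by
    rw [cos_sub, c1, c2]; nlinarith [sin_sq_add_cos_sq t']
  rw [cos_eq_one_iff_of_lt_of_lt (by linarith [pi_pos]) (by linarith [ht'.2])] at c3
  linarith

lemma wi_finish {E : Set ℝ} {X Y X' Y' : ℝ → ℝ} {Ω : Set (EuclideanSpace ℝ (Fin 2))} (ho : IsOpen Ω) (hb : Bornology.IsBounded Ω)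
    (hc : IsConnected Ω) (h0 : (0 : EuclideanSpace ℝ (Fin 2)) ∈ Ω) (hC2 : HasC2Boundary Ω)
    (h : WiPar (frontier Ω) E X Y X' Y')
    (hD : ∀ᵐ s ∂(volume.restrict E), X s * X' s + Y s * Y' s = 0) :
    ∃ r, Ω = ball 0 r := by
  obtain ⟨n, γ, hγ, hper, hd, hK⟩ := hC2
  have hKc : IsCompact (frontier Ω) := isCompact_of_isClosed_isBounded isClosed_frontier
    (hb.closure.subset frontier_subset_closure)
  have hvol : volume ((fun s => X s ^ 2 + Y s ^ 2) '' E) = 0 := by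
    have := wi_line_image E h.measE (fun s => X s ^ 2 + Y s ^ 2) (fun s => 2 * (X s * X' s + Y s * Y' s))
      (fun s hs => (((h.dX s hs).fun_pow 2).fun_add ((h.dY s hs).fun_pow 2)).congr_deriv
        (by push_cast; ring))
    refine le_antisymm (this.trans (le_of_eq ?_)) zero_le
    rw [lintegral_eq_zero_iff' (by
      have hm1 := h.mX; have hm2 := h.mY; have hm3 := h.mX'; have hm4 := h.mY'
      fun_prop)]
    filter_upwards [hD] with s hs
    simp [hs]
  have hcs : ∀ i s t, γ i s 0 ^ 2 + γ i s 1 ^ 2 = γ i t 0 ^ 2 + γ i t 1 ^ 2 := fun i s t => by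
    have := (hγ i).continuous
    refine wi_null_subsingleton (f := fun s => γ i s 0 ^ 2 + γ i s 1 ^ 2) (by fun_prop) ?_ s t
    refine measure_mono_null ?_ hvol
    rintro _ ⟨s, rfl⟩
    obtain ⟨σ, hσ, hx, hy⟩ := h.surj (γ i s) (by rw [hK]; exact Set.mem_iUnion.2 ⟨i, s, rfl⟩)
    exact ⟨σ, hσ, by simp only [hx, hy]⟩
  have hKne : (frontier Ω).Nonempty := by
    rw [nonempty_frontier_iff]
    refine ⟨⟨0, h0⟩, fun hu => ?_⟩
    rw [hu] at hb
    exact NormedSpace.unbounded_univ ℝ (EuclideanSpace ℝ (Fin 2)) hb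
  obtain ⟨z, hz, hmin⟩ := hKc.exists_isMinOn hKne continuous_norm.continuousOn
  have h0K : (0 : EuclideanSpace ℝ (Fin 2)) ∉ frontier Ω := by
    rw [ho.frontier_eq]; exact fun h => h.2 h0
  have hzpos : 0 < ‖z‖ := norm_pos_iff.2 (by rintro rfl; exact h0K hz)
  refine ⟨‖z‖, wi_ball_center ho hc h0 _ hzpos (fun w hw => hmin hw) fun w hw => ?_⟩
  rw [hK] at hz
  obtain ⟨i, t, rfl⟩ := Set.mem_iUnion.1 hz
  rw [mem_sphere_zero_iff_norm] at hw
  have e1 := wi_normsq (γ i t)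
  have e2 := wi_normsq w
  rw [hK]
  refine Set.mem_iUnion.2 ⟨i, wi_curve_sphere (γ i) (hγ i) (hper i) (hd i) (‖γ i t‖ ^ 2)
    (fun s => ?_) w ?_⟩
  · rw [hcs i s t, e1]
  · rw [← hw, e2]

section
variable {E : Set ℝ} {X Y X' Y' : ℝ → ℝ} {Ω : Set (EuclideanSpace ℝ (Fin 2))}

lemma wi_qpos (ho : IsOpen Ω) (h0 : (0 : EuclideanSpace ℝ (Fin 2)) ∈ Ω)
    (h : WiPar (frontier Ω) E X Y X' Y') : ∀ s ∈ E, 0 < X s ^ 2 + Y s ^ 2 := by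
  intro s hs
  have h1 := h.img s hs
  rw [ho.frontier_eq] at h1
  by_contra hle
  have a1 := sq_nonneg (X s)
  have a2 := sq_nonneg (Y s)
  have e1 : X s = 0 := by nlinarith
  have e2 : Y s = 0 := by nlinarith
  apply h1.2
  have : (!₂[X s, Y s] : EuclideanSpace ℝ (Fin 2)) = 0 := by
    apply wi_ext <;> simp [e1, e2]
  rw [this]; exact h0

lemma wi_cost (ho : IsOpen Ω) (h0 : (0 : EuclideanSpace ℝ (Fin 2)) ∈ Ω) (p : ℝ)
    (h : WiPar (frontier Ω) E X Y X' Y') (hv : 0 < (volume Ω).toReal)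
    (heq : ((volume Ω).toReal / π) ^ ((p + 1) / 2) =
      (1 / (2 * π)) * ∫ x in frontier Ω, ‖x‖ ^ p ∂μH[1]) :
    ∫⁻ s in E, ENNReal.ofReal ((X s ^ 2 + Y s ^ 2) ^ ((p + 1) / 2 - 1) *
      √((X s * Y' s - Y s * X' s) ^ 2 + (X s * X' s + Y s * Y' s) ^ 2)) ≤
      ENNReal.ofReal (2 * π * ((volume Ω).toReal / π) ^ ((p + 1) / 2)) := by
  have hpi := pi_pos
  have hpos : 0 < ((volume Ω).toReal / π) ^ ((p + 1) / 2) := by positivity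
  have hI : ∫ x in frontier Ω, ‖x‖ ^ p ∂μH[1] = 2 * π * ((volume Ω).toReal / π) ^ ((p + 1) / 2) := by
    rw [heq]; field_simp
  have hIntg : Integrable (fun x : EuclideanSpace ℝ (Fin 2) => ‖x‖ ^ p) (μH[1].restrict (frontier Ω)) := by
    by_contra hn
    rw [integral_undef hn] at hI
    have : 0 < 2 * π * ((volume Ω).toReal / π) ^ ((p + 1) / 2) := by positivity
    linarith
  rw [← hI, ofReal_integral_eq_lintegral_ofReal hIntg (Filter.Eventually.of_forall fun x => by
    simp only [Pi.zero_apply]; positivity)]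
  refine le_trans (le_of_eq ?_) (h.cost (fun x => ENNReal.ofReal (‖x‖ ^ p)) (by fun_prop))
  refine setLIntegral_congr_fun h.measE fun s hs => ?_
  have hq := wi_qpos ho h0 h s hs
  rw [← ENNReal.ofReal_mul (by positivity)]
  congr 1
  have e1 : (X s * Y' s - Y s * X' s) ^ 2 + (X s * X' s + Y s * Y' s) ^ 2
    = (X s ^ 2 + Y s ^ 2) * (X' s ^ 2 + Y' s ^ 2) := by ring
  rw [e1, Real.sqrt_mul hq.le, ← mul_assoc, wi_norm]
  congr 1
  simp only [Real.sqrt_eq_rpow]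
  rw [← Real.rpow_add hq]
  simp
  rw [← Real.rpow_mul hq.le]
  congr 1; ring

lemma wi_lemA (k B : ℝ) (h : WiPar (frontier Ω) E X Y X' Y')
    (hq : ∀ s ∈ E, 0 < X s ^ 2 + Y s ^ 2)
    (hc : ∫⁻ s in E, ENNReal.ofReal ((X s ^ 2 + Y s ^ 2) ^ (k - 1) *
      √((X s * Y' s - Y s * X' s) ^ 2 + (X s * X' s + Y s * Y' s) ^ 2)) ≤ ENNReal.ofReal B)
    (hl : ENNReal.ofReal B ≤ ∫⁻ s in E, ENNReal.ofReal ((X s ^ 2 + Y s ^ 2) ^ (k - 1) *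
      |X s * Y' s - Y s * X' s|)) :
    ∀ᵐ s ∂(volume.restrict E), X s * X' s + Y s * Y' s = 0 := by
  have hm1 := h.mX; have hm2 := h.mY; have hm3 := h.mX'; have hm4 := h.mY'
  have hle : ∀ s, ENNReal.ofReal ((X s ^ 2 + Y s ^ 2) ^ (k - 1) * |X s * Y' s - Y s * X' s|) ≤
     ENNReal.ofReal ((X s ^ 2 + Y s ^ 2) ^ (k - 1) *
      √((X s * Y' s - Y s * X' s) ^ 2 + (X s * X' s + Y s * Y' s) ^ 2)) := fun s => by
    apply ENNReal.ofReal_le_ofReal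
    gcongr
    apply Real.abs_le_sqrt
    nlinarith [sq_nonneg (X s * X' s + Y s * Y' s)]
  have hae := ae_eq_of_ae_le_of_lintegral_le (μ := volume.restrict E) (Filter.Eventually.of_forall hle)
    (((lintegral_mono hle).trans hc).trans_lt ENNReal.ofReal_lt_top).ne (by fun_prop) (hc.trans hl)
  filter_upwards [hae, ae_restrict_mem h.measE] with s hs hsE
  have hqs := hq s hsE
  rw [ENNReal.ofReal_eq_ofReal_iff (by positivity) (by positivity)] at hs
  have h1 := mul_left_cancel₀ (Real.rpow_pos_of_pos hqs (k - 1)).ne' hs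
  have h2 : |X s * Y' s - Y s * X' s| ^ 2 = √((X s * Y' s - Y s * X' s) ^ 2 + (X s * X' s + Y s * Y' s) ^ 2) ^ 2 := by
    rw [h1]
  rw [sq_abs, Real.sq_sqrt (by positivity)] at h2
  have : (X s * X' s + Y s * Y' s) ^ 2 = 0 := by linarith
  exact pow_eq_zero_iff (two_ne_zero) |>.1 this

lemma wi_small (ho : IsOpen Ω) (h0 : (0 : EuclideanSpace ℝ (Fin 2)) ∈ Ω) :
    ∃ r > 0, closedBall 0 r ⊆ Ω := by
  obtain ⟨r, hr, hs⟩ := Metric.isOpen_iff.1 ho 0 h0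
  exact ⟨r / 2, by positivity, (closedBall_subset_ball (by linarith)).trans hs⟩

lemma wi_case0 (hb : Bornology.IsBounded Ω) (ho : IsOpen Ω) (h0 : (0 : EuclideanSpace ℝ (Fin 2)) ∈ Ω)
    (h : WiPar (frontier Ω) E X Y X' Y') :
    ENNReal.ofReal (2 * π) ≤ ∫⁻ s in E, ENNReal.ofReal ((X s ^ 2 + Y s ^ 2) ^ ((0:ℝ) - 1) *
      |X s * Y' s - Y s * X' s|) := by
  have hm1 := h.mX; have hm2 := h.mY; have hm3 := h.mX'; have hm4 := h.mY'
  obtain ⟨r, hr, hrs⟩ := wi_small ho h0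
  have := wi_ballbd hb h r hr ((sphere_subset_closedBall.trans hrs).trans subset_closure)
  replace this := this.trans (lintegral_mono_set Set.inter_subset_left)
  rw [ENNReal.ofReal_mul (by norm_num)]
  refine (mul_le_mul_right this (ENNReal.ofReal 2)).trans ?_
  rw [← lintegral_const_mul _ (by fun_prop)]
  refine lintegral_mono fun s => ?_
  rw [← ENNReal.ofReal_mul (by norm_num)]
  apply le_of_eq
  congr 1
  rw [zero_sub, Real.rpow_neg_one]
  ring

lemma wi_case1 (hb : Bornology.IsBounded Ω) (ho : IsOpen Ω) (h0 : (0 : EuclideanSpace ℝ (Fin 2)) ∈ Ω)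
    (h : WiPar (frontier Ω) E X Y X' Y') (k a : ℝ) (hk : 1 ≤ k) (ha : 0 < a)
    (hv : volume Ω = ENNReal.ofReal (π * a)) :
    ENNReal.ofReal (2 * π * a ^ k) ≤ ∫⁻ s in E, ENNReal.ofReal ((X s ^ 2 + Y s ^ 2) ^ (k - 1) *
      |X s * Y' s - Y s * X' s|) := by
  have hm1 := h.mX; have hm2 := h.mY; have hm3 := h.mX'; have hm4 := h.mY'
  have hpi := pi_pos
  have hk0 : 0 < k := by linarith
  obtain ⟨r, hr, hrs⟩ := wi_small ho h0
  have hq2 : 0 ≤ (k - 1) * a / k := by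
    have : 0 ≤ k - 1 := by linarith
    positivity
  have := wi_annulus hb h r hr ((sphere_subset_closedBall.trans hrs).trans subset_closure)
    (√((k - 1) * a / k)) (Real.sqrt_nonneg _)
  rw [Real.sq_sqrt hq2, hv] at this
  have hak : a ^ k = a ^ (k - 1) * a := by
    rw [Real.rpow_sub_one ha.ne']; field_simp
  have h2 := mul_le_mul_right this (ENNReal.ofReal (2 * k * a ^ (k - 1)))
  rw [mul_add, ← ENNReal.ofReal_mul (by positivity), ← ENNReal.ofReal_mul (by positivity),
    ← lintegral_const_mul _ (by fun_prop)] at h2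
  have e1 : 2 * k * a ^ (k - 1) * (π * a) = 2 * k * a ^ (k - 1) * (π * ((k - 1) * a / k)) + 2 * π * a ^ k := by
    rw [hak]; field_simp; ring
  rw [e1, ENNReal.ofReal_add (by positivity) (by positivity)] at h2
  have h3 := ENNReal.le_of_add_le_add_left ENNReal.ofReal_ne_top h2
  refine h3.trans (setLIntegral_mono (by fun_prop) fun s hs => ?_)
  have hq := wi_qpos ho h0 h s hs
  rw [← ENNReal.ofReal_mul (by positivity)]
  apply ENNReal.ofReal_le_ofReal
  set q := X s ^ 2 + Y s ^ 2
  have key : k * a ^ (k - 1) * max 0 (1 - (k - 1) * a / k / q) ≤ q ^ (k - 1) := by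
    rw [mul_max_of_nonneg _ _ (by positivity), mul_zero]
    apply max_le (by positivity)
    have hB := one_add_mul_self_le_rpow_one_add (s := q / a - 1) (by
      have : 0 ≤ q / a := by positivity
      linarith) hk
    rw [add_sub_cancel, Real.div_rpow hq.le ha.le, le_div_iff₀ (by positivity), hak,
      show q ^ k = q ^ (k - 1) * q by rw [Real.rpow_sub_one hq.ne']; field_simp] at hB
    rw [← mul_le_mul_iff_of_pos_right hq]
    refine le_trans (le_of_eq ?_) hB
    field_simp
    ring
  have := mul_le_mul_of_nonneg_right key (abs_nonneg (X s * Y' s - Y s * X' s))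
  linarith

end

lemma wi_chord_out (k : ℝ) (hk : 0 < k) (hk1 : k < 1) (α β q0 q1 a : ℝ) (ha : 0 < a)
    (haq : a ≤ q0) (hqb : q0 < q1)
    (h1 : α * q0 + β = q0 ^ k) (h2 : α * q1 + β = q1 ^ k) : a ^ k ≤ α * a + β := by
  rcases haq.eq_or_lt with rfl | hlt
  · exact h1.ge
  have hne : q1 - a ≠ 0 := by intro h; linarith
  have := wi_chord k hk hk1 ((q1 ^ k - a ^ k) / (q1 - a)) (a ^ k - (q1 ^ k - a ^ k) / (q1 - a) * a)
    a q1 q0 ha hlt hqb (by ring) (by field_simp; ring)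
  set α' := (q1 ^ k - a ^ k) / (q1 - a)
  have e1 : α' * (q1 - a) = q1 ^ k - a ^ k := by simp only [α']; field_simp
  by_contra hcon
  push Not at hcon
  have f1 : (α' - α) * (q0 - q1) < 0 := by nlinarith
  have f2 : 0 < (α' - α) * (a - q1) := by nlinarith
  have f3 : 0 < α' - α := by nlinarith
  nlinarith

lemma wi_chord_pos (k : ℝ) (hk : 0 < k) (hk1 : k < 1) (q0 q1 : ℝ) (h0 : 0 < q0) (h01 : q0 < q1) :
    ∃ α β : ℝ, 0 < α ∧ 0 < β ∧ α * q0 + β = q0 ^ k ∧ α * q1 + β = q1 ^ k := by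
  have hd : 0 < q1 - q0 := by linarith
  have h1 : 0 < q1 := by linarith
  refine ⟨(q1 ^ k - q0 ^ k) / (q1 - q0), q0 ^ k - (q1 ^ k - q0 ^ k) / (q1 - q0) * q0, ?_, ?_, by ring,
    by field_simp; ring⟩
  · have := Real.rpow_lt_rpow h0.le h01 hk
    exact div_pos (by linarith) hd
  · have := Real.rpow_lt_rpow_of_neg h0 h01 (show k - 1 < 0 by linarith)
    rw [Real.rpow_sub_one h0.ne', Real.rpow_sub_one h1.ne', div_lt_div_iff₀ h1 h0] at this
    rw [sub_pos, div_mul_eq_mul_div, div_lt_iff₀ hd]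
    linarith

section
variable {E : Set ℝ} {X Y X' Y' : ℝ → ℝ} {Ω : Set (EuclideanSpace ℝ (Fin 2))}

lemma wi_radii (hb : Bornology.IsBounded Ω) (ho : IsOpen Ω) (hc : IsConnected Ω)
    (h0 : (0 : EuclideanSpace ℝ (Fin 2)) ∈ Ω) :
    ∃ r0 r1 : ℝ, 0 < r0 ∧ r0 ≤ r1 ∧ sphere 0 r0 ⊆ closure Ω ∧ (∀ z ∈ closure Ω, ‖z‖ ≤ r1) ∧
      ∀ r, r0 < r → r < r1 → ∃ z ∈ frontier Ω, ∃ z' ∈ frontier Ω, z ≠ z' ∧ ‖z‖ = r ∧ ‖z'‖ = r := by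
  have hcl : IsCompact (closure Ω) := hb.isCompact_closure
  obtain ⟨z1, hz1, hmax⟩ := hcl.exists_isMaxOn ⟨0, subset_closure h0⟩ continuous_norm.continuousOn
  set r1 := ‖z1‖
  have hmax' : ∀ z ∈ closure Ω, ‖z‖ ≤ r1 := fun z hz => hmax hz
  let T : Set ℝ := Set.Icc 0 r1 ∩ ⋂ u ∈ sphere (0 : EuclideanSpace ℝ (Fin 2)) 1, {r | r • u ∈ closure Ω}
  have hTc : IsCompact T := isCompact_Icc.inter_right (isClosed_biInter fun u _ =>
    isClosed_closure.preimage (f := fun r : ℝ => r • u) (by fun_prop))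
  have hT : ∀ r, r ∈ T ↔ (0 ≤ r ∧ r ≤ r1) ∧ ∀ u : EuclideanSpace ℝ (Fin 2), ‖u‖ = 1 → r • u ∈ closure Ω :=
    fun r => by simp [T]
  obtain ⟨r, hr, hrs⟩ := wi_small ho h0
  have hrT : r ∈ T := by
    rw [hT]
    have h1 : ∀ u : EuclideanSpace ℝ (Fin 2), ‖u‖ = 1 → r • u ∈ closure Ω := fun u hu =>
      subset_closure (hrs (by simp [norm_smul, hu, abs_of_pos hr]))
    have h2 := hmax' _ (h1 (EuclideanSpace.single 0 1) (by simp))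
    rw [norm_smul] at h2
    simp [abs_of_pos hr] at h2
    exact ⟨⟨hr.le, h2⟩, h1⟩
  obtain ⟨r0, hr0, hgr⟩ := hTc.exists_isGreatest ⟨r, hrT⟩
  have hr0p : 0 < r0 := hr.trans_le (hgr hrT)
  have hr0' := (hT r0).1 hr0
  refine ⟨r0, r1, hr0p, hr0'.1.2, fun z hz => ?_, hmax', fun t ht0 ht1 => ?_⟩
  · rw [mem_sphere_zero_iff_norm] at hz
    have := hr0'.2 (r0⁻¹ • z) (by rw [norm_smul, hz, norm_inv, Real.norm_of_nonneg hr0p.le]; field_simp)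
    rwa [smul_smul, mul_inv_cancel₀ hr0p.ne', one_smul] at this
  · have htT : t ∉ T := fun h => absurd (hgr h) (not_le.2 ht0)
    rw [hT] at htT
    have htp : 0 < t := hr0p.trans ht0
    push Not at htT
    obtain ⟨u, hu, hun⟩ := htT ⟨htp.le, ht1.le⟩
    obtain ⟨w', hw', hw'2⟩ := mem_closure_iff.1 hz1 {z | t < ‖z‖}
      (isOpen_lt continuous_const continuous_norm) ht1
    have hpre := hc.isPreconnected.image norm continuous_norm.continuousOn
    obtain ⟨w, hw, hwt⟩ := hpre.Icc_subset ⟨0, h0, norm_zero⟩ ⟨w', hw'2, rfl⟩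
      ⟨htp.le, le_of_lt hw'⟩
    exact wi_twosphere ho t w (t • u) hw hun htp hwt (by simp [norm_smul, hu, abs_of_pos htp])

lemma wi_cs (m l Q C D : ℝ) (hQ : m ^ 2 + l ^ 2 = Q ^ 2) (hQ0 : 0 ≤ Q) :
    l * |C| + m * |D| ≤ Q * √(C ^ 2 + D ^ 2) := by
  have h1 : Q * √(C ^ 2 + D ^ 2) = √(Q ^ 2 * (C ^ 2 + D ^ 2)) := by
    rw [Real.sqrt_mul (by positivity), Real.sqrt_sq hQ0]
  rw [h1]
  apply Real.le_sqrt_of_sq_le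
  rw [← sq_abs C, ← sq_abs D, ← hQ]
  nlinarith [sq_nonneg (l * |D| - m * |C|)]

lemma wi_mid_lower (hb : Bornology.IsBounded Ω) (ho : IsOpen Ω)
    (h0 : (0 : EuclideanSpace ℝ (Fin 2)) ∈ Ω) (h : WiPar (frontier Ω) E X Y X' Y')
    (k a : ℝ) (hk : 0 < k) (hk1 : k < 1) (ha : 0 < a) (hv : volume Ω = ENNReal.ofReal (π * a))
    (r0 r1 : ℝ) (hr0 : 0 < r0) (hr01 : r0 < r1) (hs0 : sphere 0 r0 ⊆ closure Ω)
    (hd : ∀ r, r0 < r → r < r1 → ∃ z ∈ frontier Ω, ∃ z' ∈ frontier Ω, z ≠ z' ∧ ‖z‖ = r ∧ ‖z'‖ = r)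
    (hmax : ∀ z ∈ closure Ω, ‖z‖ ≤ r1)
    (α β : ℝ) (hα : 0 < α) (hβ : 0 < β) (e0 : α * r0 ^ 2 + β = (r0 ^ 2) ^ k)
    (e1 : α * r1 ^ 2 + β = (r1 ^ 2) ^ k) :
    ENNReal.ofReal (2 * π * (α * a + β)) + ∫⁻ q in Set.Ioo (r0 ^ 2) (r1 ^ 2),
      ENNReal.ofReal (√(q ^ (2 * k) - (α * q + β) ^ 2) / q) ≤
    ∫⁻ s in E, ENNReal.ofReal ((X s ^ 2 + Y s ^ 2) ^ (k - 1) *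
      √((X s * Y' s - Y s * X' s) ^ 2 + (X s * X' s + Y s * Y' s) ^ 2)) := by
  have hm1 := h.mX; have hm2 := h.mY; have hm3 := h.mX'; have hm4 := h.mY'
  have hpi := pi_pos
  have hKc : IsCompact (frontier Ω) := isCompact_of_isClosed_isBounded isClosed_frontier
    (hb.closure.subset frontier_subset_closure)
  have hq01 : r0 ^ 2 < r1 ^ 2 := by gcongr
  have hq0 : 0 < r0 ^ 2 := by positivity
  let G0 : ℝ → ENNReal := fun q => ENNReal.ofReal (√(q ^ (2 * k) - (α * q + β) ^ 2) / q)
  have hG0 : Measurable G0 := by simp only [G0]; fun_prop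
  let G : ℝ → ENNReal := (Set.Ioo (r0 ^ 2) (r1 ^ 2)).indicator G0
  have hG : Measurable G := hG0.indicator measurableSet_Ioo
  -- double covering
  have hdouble := wi_double h hKc (fun z => z 0 ^ 2 + z 1 ^ 2) (by fun_prop)
    (fun s => X s ^ 2 + Y s ^ 2) (fun s => 2 * (X s * X' s + Y s * Y' s)) (fun s => by simp)
    (by fun_prop) (by fun_prop)
    (fun s hs => (((h.dX s hs).fun_pow 2).fun_add ((h.dY s hs).fun_pow 2)).congr_deriv
        (by push_cast; ring)) (Set.Ioo (r0 ^ 2) (r1 ^ 2)) (fun t ht => by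
      have htp : 0 < t := hq0.trans ht.1
      obtain ⟨z, hz, z', hz', hne, hn, hn'⟩ := hd (√t) (Real.lt_sqrt_of_sq_lt ht.1)
        ((Real.sqrt_lt' (by linarith)).2 ht.2)
      refine ⟨z, hz, z', hz', hne, ?_, ?_⟩
      · simp only; rw [← wi_normsq, hn, Real.sq_sqrt htp.le]
      · simp only; rw [← wi_normsq, hn', Real.sq_sqrt htp.le]) G hG
  have hdouble2 : ∫⁻ q in Set.Ioo (r0 ^ 2) (r1 ^ 2), G0 q ≤
      ∫⁻ s in E, G (X s ^ 2 + Y s ^ 2) * ENNReal.ofReal |X s * X' s + Y s * Y' s| := by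
    have e2 : ∫⁻ s in E, G (X s ^ 2 + Y s ^ 2) * ENNReal.ofReal |2 * (X s * X' s + Y s * Y' s)| =
       2 * ∫⁻ s in E, G (X s ^ 2 + Y s ^ 2) * ENNReal.ofReal |X s * X' s + Y s * Y' s| := by
      rw [← lintegral_const_mul _ (by fun_prop)]
      refine lintegral_congr fun s => ?_
      rw [abs_mul, ENNReal.ofReal_mul (by positivity)]
      simp
      ring
    rw [e2] at hdouble
    have := (ENNReal.mul_le_mul_iff_right (a := 2) (by norm_num) (by norm_num)).1 hdouble
    refine le_trans (le_of_eq ?_) this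
    refine setLIntegral_congr_fun measurableSet_Ioo fun q hq => ?_
    simp only [G, Set.indicator_of_mem hq]
  -- C part
  set S := E ∩ {s | r0 ^ 2 ≤ X s ^ 2 + Y s ^ 2} with hS
  have hSm : MeasurableSet S := wi_measE' h r0
  have hA := wi_area hb h r0 hr0 hs0
  have hB := wi_ballbd hb h r0 hr0 hs0
  have hC : ENNReal.ofReal (2 * π * (α * a + β)) ≤ ∫⁻ s in E, S.indicator (fun s => ENNReal.ofReal
      ((α * (X s ^ 2 + Y s ^ 2) + β) / (X s ^ 2 + Y s ^ 2) * |X s * Y' s - Y s * X' s|)) s := by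
    rw [lintegral_indicator hSm, Measure.restrict_restrict hSm, Set.inter_eq_left.2 Set.inter_subset_left]
    have hA' := mul_le_mul_right hA (ENNReal.ofReal (2 * α))
    have hB' := mul_le_mul_right hB (ENNReal.ofReal (2 * β))
    rw [hv, ← ENNReal.ofReal_mul (by positivity), ← lintegral_const_mul _ (by fun_prop)] at hA'
    rw [← ENNReal.ofReal_mul (by positivity), ← lintegral_const_mul _ (by fun_prop)] at hB'
    have := add_le_add hA' hB'
    rw [← ENNReal.ofReal_add (by positivity) (by positivity), ← lintegral_add_left (by fun_prop)] at this
    refine le_trans (le_of_eq ?_) (this.trans (setLIntegral_mono (by fun_prop) fun s hs => ?_))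
    · congr 1; ring
    · have hq := wi_qpos ho h0 h s hs.1
      rw [← ENNReal.ofReal_mul (by positivity), ← ENNReal.ofReal_mul (by positivity),
        ← ENNReal.ofReal_add (by positivity) (by positivity)]
      apply ENNReal.ofReal_le_ofReal
      apply le_of_eq
      field_simp
  refine (add_le_add hC hdouble2).trans ?_
  rw [← lintegral_add_right _ (by fun_prop)]
  refine setLIntegral_mono (by fun_prop) fun s hs => ?_
  have hq := wi_qpos ho h0 h s hs
  have hqle : X s ^ 2 + Y s ^ 2 ≤ r1 ^ 2 := by
    have := hmax _ (frontier_subset_closure (h.img s hs))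
    have h3 : ‖(!₂[X s, Y s] : EuclideanSpace ℝ (Fin 2))‖ ^ 2 ≤ r1 ^ 2 := by gcongr
    rw [wi_normsq] at h3
    simpa using h3
  set q := X s ^ 2 + Y s ^ 2 with hqdef
  have hqk : q ^ (k - 1) = q ^ k / q := Real.rpow_sub_one hq.ne' k
  have hq2k : q ^ (2 * k) = (q ^ k) ^ 2 := by rw [mul_comm, Real.rpow_mul hq.le]; norm_cast
  by_cases hsS : s ∈ S
  · have hq0q : r0 ^ 2 ≤ q := hsS.2
    rw [Set.indicator_of_mem hsS]
    have hl : α * q + β ≤ q ^ k := by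
      rcases hq0q.eq_or_lt with h4 | h4
      · rw [← h4, e0]
      rcases hqle.eq_or_lt with h5 | h5
      · rw [h5, e1]
      exact (wi_chord k hk hk1 α β _ _ q hq0 h4 h5 e0 e1).le
    have hGle : G q ≤ G0 q := Set.indicator_le_self _ _ _
    refine (add_le_add le_rfl (mul_le_mul_left hGle _)).trans ?_
    simp only [G0]
    rw [← ENNReal.ofReal_mul (by positivity), ← ENNReal.ofReal_add (by positivity) (by positivity)]
    apply ENNReal.ofReal_le_ofReal
    have hcs := wi_cs (√(q ^ (2 * k) - (α * q + β) ^ 2)) (α * q + β) (q ^ k)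
      (X s * Y' s - Y s * X' s) (X s * X' s + Y s * Y' s) (by
        rw [Real.sq_sqrt, hq2k]
        · ring
        · rw [hq2k, sub_nonneg]; gcongr) (by positivity)
    rw [hqk]
    have := div_le_div_of_nonneg_right hcs hq.le
    refine le_trans (le_of_eq ?_) (this.trans (le_of_eq ?_))
    · ring
    · ring
  · rw [Set.indicator_of_notMem hsS]
    have : q ∉ Set.Ioo (r0 ^ 2) (r1 ^ 2) := fun hm => hsS ⟨hs, hm.1.le⟩
    simp [G, Set.indicator_of_notMem this]

lemma wi_mid (hb : Bornology.IsBounded Ω) (ho : IsOpen Ω) (hc : IsConnected Ω)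
    (h0 : (0 : EuclideanSpace ℝ (Fin 2)) ∈ Ω) (h : WiPar (frontier Ω) E X Y X' Y')
    (k a : ℝ) (hk : 0 < k) (hk1 : k < 1) (hk2 : k ≠ 1 / 2) (ha : 0 < a)
    (hv : volume Ω = ENNReal.ofReal (π * a))
    (hcost : ∫⁻ s in E, ENNReal.ofReal ((X s ^ 2 + Y s ^ 2) ^ (k - 1) *
      √((X s * Y' s - Y s * X' s) ^ 2 + (X s * X' s + Y s * Y' s) ^ 2)) ≤
        ENNReal.ofReal (2 * π * a ^ k)) :
    ENNReal.ofReal (2 * π * a ^ k) ≤ ∫⁻ s in E, ENNReal.ofReal ((X s ^ 2 + Y s ^ 2) ^ (k - 1) *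
      |X s * Y' s - Y s * X' s|) := by
  have hm1 := h.mX; have hm2 := h.mY; have hm3 := h.mX'; have hm4 := h.mY'
  have hpi := pi_pos
  obtain ⟨r0, r1, hr0, hr01, hs0, hmax, hd⟩ := wi_radii hb ho hc h0
  have hr1 : 0 < r1 := by linarith
  have haq1 : a ≤ r1 ^ 2 := by
    have : volume Ω ≤ volume (ball (0 : EuclideanSpace ℝ (Fin 2)) r1) := by
      rw [← interior_closedBall _ hr1.ne']
      exact measure_mono (interior_maximal (fun z hz => mem_closedBall_zero_iff.2
        (hmax z (subset_closure hz))) ho)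
    rw [hv, wi_vol_ball _ hr1.le, ENNReal.ofReal_le_ofReal_iff (by positivity)] at this
    exact le_of_mul_le_mul_left this hpi
  rcases hr01.eq_or_lt with heq | hlt
  · have hB := wi_ballbd hb h r0 hr0 hs0
    have hB' := mul_le_mul_right hB (ENNReal.ofReal (2 * a ^ k))
    rw [← ENNReal.ofReal_mul (by positivity), ← lintegral_const_mul _ (by fun_prop)] at hB'
    refine le_trans (le_of_eq (by congr 1; ring)) (hB'.trans ?_)
    refine le_trans ?_ (lintegral_mono_set (Set.inter_subset_left (t := {s | r0 ^ 2 ≤ X s ^ 2 + Y s ^ 2})))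
    refine setLIntegral_mono (by fun_prop) fun s hs => ?_
    have hq := wi_qpos ho h0 h s hs.1
    rw [← ENNReal.ofReal_mul (by positivity)]
    apply ENNReal.ofReal_le_ofReal
    have haq : a ≤ X s ^ 2 + Y s ^ 2 := by
      have := hs.2
      simp only [Set.mem_ofPred_eq] at this
      rw [heq] at this
      linarith
    rw [Real.rpow_sub_one hq.ne']
    have := Real.rpow_le_rpow ha.le haq hk.le
    have h5 : a ^ k * (|X s * Y' s - Y s * X' s| / (X s ^ 2 + Y s ^ 2)) ≤
      (X s ^ 2 + Y s ^ 2) ^ k * (|X s * Y' s - Y s * X' s| / (X s ^ 2 + Y s ^ 2)) := by gcongr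
    refine le_trans (le_of_eq ?_) (h5.trans (le_of_eq ?_)) <;> ring
  · exfalso
    have hq01 : r0 ^ 2 < r1 ^ 2 := by gcongr
    have hq0 : 0 < r0 ^ 2 := by positivity
    obtain ⟨α, β, hα, hβ, e0, e1⟩ := wi_chord_pos k hk hk1 _ _ hq0 hq01
    have hlow := wi_mid_lower hb ho h0 h k a hk hk1 ha hv r0 r1 hr0 hlt hs0 hd hmax α β hα hβ e0 e1
    have hall := hlow.trans hcost
    have hc0 : 0 < k * (1 - k) := mul_pos hk (by linarith)
    have hcc : √(k * (1 - k)) < 1 / 2 := by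
      rw [Real.sqrt_lt' (by norm_num)]
      have : 0 < (k - 1 / 2) ^ 2 := by
        have : k - 1 / 2 ≠ 0 := sub_ne_zero.2 hk2
        positivity
      nlinarith
    have hcp : 0 < √(k * (1 - k)) := Real.sqrt_pos.2 hc0
    have main : ∀ x, r0 ^ 2 < x → x < r1 ^ 2 →
        2 * π * (α * a + β) + π / √(k * (1 - k)) * (x ^ k - α * x - β) ≤ 2 * π * a ^ k := by
      intro x hx0 hx1
      have hch := wi_chord k hk hk1 α β _ _ x hq0 hx0 hx1 e0 e1
      have hphi := wi_phi k α β _ x _ hk hk1 hα hβ hq0 hx0 hx1 e0 e1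
      have h6 := (add_le_add (le_refl (ENNReal.ofReal (2 * π * (α * a + β)))) hphi).trans hall
      rw [← ENNReal.ofReal_add (by positivity) (mul_nonneg (by positivity) (by linarith)),
        ENNReal.ofReal_le_ofReal_iff (by positivity)] at h6
      exact h6
    have hlarge : 2 * π < π / √(k * (1 - k)) := by
      rw [lt_div_iff₀ hcp]; nlinarith
    have hout : a ^ k ≤ α * a + β → False := fun hle => by
      have hx := main ((r0 ^ 2 + r1 ^ 2) / 2) (by linarith) (by linarith)
      have hch := wi_chord k hk hk1 α β _ _ ((r0 ^ 2 + r1 ^ 2) / 2) hq0 (by linarith) (by linarith) e0 e1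
      have : 0 < π / √(k * (1 - k)) * (((r0 ^ 2 + r1 ^ 2) / 2) ^ k - α * ((r0 ^ 2 + r1 ^ 2) / 2) - β) :=
        mul_pos (by positivity) (by linarith)
      nlinarith
    rcases le_or_gt a (r0 ^ 2) with h7 | h7
    · exact hout (wi_chord_out k hk hk1 α β _ _ a ha h7 hq01 e0 e1)
    rcases haq1.eq_or_lt with h8 | h8
    · apply hout; rw [h8, e1]
    · have hx := main a h7 h8
      have hch := wi_chord k hk hk1 α β _ _ a hq0 h7 h8 e0 e1
      have : 2 * π * (a ^ k - α * a - β) < π / √(k * (1 - k)) * (a ^ k - α * a - β) :=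
        mul_lt_mul_of_pos_right hlarge (by linarith)
      nlinarith

end

lemma wi_halfdisc (c ρ : ℝ) (hρ : 0 < ρ) :
    ∫⁻ t in Set.Ioo (c - ρ) (c + ρ), ENNReal.ofReal (√(ρ ^ 2 - (t - c) ^ 2)) =
      ENNReal.ofReal (π * ρ ^ 2 / 2) := by
  have hcont : Continuous (fun t : ℝ => √(ρ ^ 2 - (t - c) ^ 2)) := by fun_prop
  have hIntg : IntegrableOn (fun t : ℝ => √(ρ ^ 2 - (t - c) ^ 2)) (Set.Ioo (c - ρ) (c + ρ)) :=
    (hcont.integrableOn_Icc).mono_set Set.Ioo_subset_Icc_self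
  rw [← ofReal_integral_eq_lintegral_ofReal hIntg (Filter.Eventually.of_forall fun x => Real.sqrt_nonneg _)]
  congr 1
  rw [← integral_Ioc_eq_integral_Ioo, ← intervalIntegral.integral_of_le (by linarith)]
  have h1 := intervalIntegral.smul_integral_comp_add_mul (a := -1) (b := 1)
    (fun t : ℝ => √(ρ ^ 2 - (t - c) ^ 2)) ρ c
  have e1 : c + ρ * -1 = c - ρ := by ring
  have e2 : c + ρ * 1 = c + ρ := by ring
  rw [e1, e2] at h1
  rw [← h1]
  have e3 : ∀ x : ℝ, √(ρ ^ 2 - (c + ρ * x - c) ^ 2) = ρ * √(1 - x ^ 2) := fun x => by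
    rw [show ρ ^ 2 - (c + ρ * x - c) ^ 2 = ρ ^ 2 * (1 - x ^ 2) by ring, Real.sqrt_mul (by positivity),
      Real.sqrt_sq hρ.le]
  simp only [e3, intervalIntegral.integral_const_mul, integral_sqrt_one_sub_sq, smul_eq_mul]
  ring

lemma wi_zero_core {E : Set ℝ} (hE : MeasurableSet E) {U U' V' : ℝ → ℝ} (hU : Measurable U)
    (hU' : Measurable U') (hV' : Measurable V') (c ρ a : ℝ) (hρ : 0 < ρ) (ha : 0 < a)
    (hb : ∀ s ∈ E, |U s - c| ≤ ρ)
    (h1 : ENNReal.ofReal (π * ρ ^ 2) ≤ ∫⁻ s in E, ENNReal.ofReal (√(ρ ^ 2 - (U s - c) ^ 2)) * ENNReal.ofReal |U' s|)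
    (h2 : ENNReal.ofReal (π * a) ≤ ∫⁻ s in E, ENNReal.ofReal (|U s - c| * |V' s|))
    (hcost : ∫⁻ s in E, ENNReal.ofReal (√(V' s ^ 2 + U' s ^ 2)) ≤ ENNReal.ofReal (2 * π * √a)) :
    ρ ^ 2 = a ∧ ∀ᵐ s ∂(volume.restrict E), (U s - c) ^ 2 * (V' s ^ 2 + U' s ^ 2) = ρ ^ 2 * V' s ^ 2 := by
  have hpi := pi_pos
  have hsa : √a ^ 2 = a := Real.sq_sqrt ha.le
  have hs0 : 0 < √a := Real.sqrt_pos.2 ha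
  let f : ℝ → ENNReal := fun s => ENNReal.ofReal (|U s - c| * |V' s| + √(ρ ^ 2 - (U s - c) ^ 2) * |U' s|)
  let g : ℝ → ENNReal := fun s => ENNReal.ofReal (ρ * √(V' s ^ 2 + U' s ^ 2))
  have hη : ∀ s ∈ E, 0 ≤ ρ ^ 2 - (U s - c) ^ 2 := fun s hs => by
    rw [sub_nonneg, ← sq_abs (U s - c)]
    have := hb s hs
    gcongr
  have hfg : ∀ s ∈ E, f s ≤ g s := fun s hs => by
    apply ENNReal.ofReal_le_ofReal
    apply wi_cs _ _ _ _ _ _ hρ.le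
    rw [Real.sq_sqrt (hη s hs), sq_abs]; ring
  have hgm : Measurable g := by simp only [g]; fun_prop
  have hfm : Measurable f := by simp only [f]; fun_prop
  have hg : ∫⁻ s in E, g s ≤ ENNReal.ofReal (2 * π * √a * ρ) := by
    have := mul_le_mul_right hcost (ENNReal.ofReal ρ)
    rw [← lintegral_const_mul _ (by fun_prop), ← ENNReal.ofReal_mul hρ.le] at this
    refine le_trans (le_of_eq (lintegral_congr fun s => ?_)) (this.trans (le_of_eq (by congr 1; ring)))
    simp only [g]
    rw [← ENNReal.ofReal_mul hρ.le]
  have hf : ENNReal.ofReal (π * a + π * ρ ^ 2) ≤ ∫⁻ s in E, f s := by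
    rw [ENNReal.ofReal_add (by positivity) (by positivity)]
    refine (add_le_add h2 h1).trans ?_
    rw [← lintegral_add_left (by fun_prop)]
    refine le_of_eq (lintegral_congr fun s => ?_)
    rw [← ENNReal.ofReal_mul (by positivity), ← ENNReal.ofReal_add (by positivity) (by positivity)]
  have hmono := setLIntegral_mono (μ := volume) (s := E) hgm hfg
  have h3 := hf.trans (hmono.trans hg)
  rw [ENNReal.ofReal_le_ofReal_iff (by positivity)] at h3
  have h4 : π * (√a - ρ) ^ 2 ≤ 0 := by nlinarith
  have h5 : (√a - ρ) ^ 2 = 0 := le_antisymm (by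
    by_contra hcon; push Not at hcon
    have := mul_pos hpi hcon
    linarith) (sq_nonneg _)
  have h6 : √a = ρ := by
    have := pow_eq_zero_iff (two_ne_zero) |>.1 h5
    linarith
  refine ⟨by rw [← h6, hsa], ?_⟩
  have h7 : ∫⁻ s in E, g s ≤ ∫⁻ s in E, f s := by
    refine hg.trans (le_trans (le_of_eq ?_) hf)
    congr 1
    rw [← h6, ← hsa]
    rw [Real.sqrt_sq hs0.le]; ring
  have hae := ae_eq_of_ae_le_of_lintegral_le (μ := volume.restrict E) (f := f) (g := g)
    ((ae_restrict_iff' hE).2 (Filter.Eventually.of_forall hfg))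
    ((hmono.trans hg).trans_lt ENNReal.ofReal_lt_top).ne hgm.aemeasurable h7
  filter_upwards [hae, ae_restrict_mem hE] with s hs hsE
  simp only [f, g] at hs
  rw [ENNReal.ofReal_eq_ofReal_iff (by positivity) (by positivity)] at hs
  have h8 : (ρ * √(V' s ^ 2 + U' s ^ 2)) ^ 2 = (|U s - c| * |V' s| + √(ρ ^ 2 - (U s - c) ^ 2) * |U' s|) ^ 2 := by
    rw [hs]
  have hη2 := Real.sq_sqrt (hη s hsE)
  rw [mul_pow, Real.sq_sqrt (by positivity)] at h8
  set η := √(ρ ^ 2 - (U s - c) ^ 2)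
  have i1 := sq_abs (U s - c)
  have i2 := sq_abs (U' s)
  have i3 := sq_abs (V' s)
  rw [← i1] at hη2 ⊢
  rw [← i2, ← i3] at h8 ⊢
  have h9 : (η * |V' s| - |U s - c| * |U' s|) ^ 2 = 0 := by
    linear_combination (|V' s| ^ 2 + |U' s| ^ 2) * hη2 + h8
  have h10 := pow_eq_zero_iff (two_ne_zero) |>.1 h9
  linear_combination (η * |V' s| + |U s - c| * |U' s|) * (-h10) + |V' s| ^ 2 * hη2

lemma wi_ray_dir {Ω : Set (EuclideanSpace ℝ (Fin 2))} (hb : Bornology.IsBounded Ω) (ho : IsOpen Ω)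
    (w v : EuclideanSpace ℝ (Fin 2)) (hw : w ∈ Ω) (hv : v ≠ 0) :
    ∃ μ : ℝ, 0 < μ ∧ w + μ • v ∈ frontier Ω := by
  have hpre : IsPreconnected ((fun μ : ℝ => w + μ • v) '' Set.Ici 0) :=
    isPreconnected_Ici.image _ (by fun_prop)
  obtain ⟨R, hR⟩ := hb.subset_closedBall w
  have hw1 : 0 < ‖v‖ := norm_pos_iff.2 hv
  obtain ⟨z, ⟨μ, hμ, rfl⟩, hz⟩ := wi_pre_front hpre (A := Ω) ⟨w, ⟨0, Set.mem_Ici.2 le_rfl, by simp⟩, hw⟩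
    ⟨_, ⟨max 0 ((R + 1) / ‖v‖), Set.mem_Ici.2 (le_max_left _ _), rfl⟩, fun hmem => by
      have h4 := hR hmem
      rw [mem_closedBall, dist_eq_norm, add_sub_cancel_left, norm_smul,
        Real.norm_of_nonneg (le_max_left _ _)] at h4
      have h5 : (R + 1) / ‖v‖ * ‖v‖ ≤ max 0 ((R + 1) / ‖v‖) * ‖v‖ := by
        gcongr; exact le_max_right _ _
      rw [div_mul_cancel₀ _ hw1.ne'] at h5
      linarith⟩
  refine ⟨μ, lt_of_le_of_ne hμ ?_, hz⟩
  rintro rfl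
  rw [ho.frontier_eq] at hz
  apply hz.2
  simpa using hw

lemma wi_hit {Ω : Set (EuclideanSpace ℝ (Fin 2))} (hb : Bornology.IsBounded Ω) (ho : IsOpen Ω)
    (j : Fin 2) (c : ℝ) (w : EuclideanSpace ℝ (Fin 2)) (hw : w ∈ Ω) :
    ∃ z ∈ frontier Ω, (∃ l ∈ Set.Icc (0:ℝ) 1, w j = c + l * (z j - c)) ∧ ∀ i, i ≠ j → w i = z i := by
  rcases le_or_gt c (w j) with hcw | hcw
  · obtain ⟨μ, hμ, hz⟩ := wi_ray_dir hb ho w (EuclideanSpace.single j 1) hw (by simp)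
    refine ⟨_, hz, ⟨(w j - c) / (w j + μ - c), ⟨div_nonneg (by linarith) (by linarith),
      (div_le_one (by linarith)).2 (by linarith)⟩, ?_⟩, fun i hi => by simp [hi]⟩
    have : w j + μ - c ≠ 0 := by intro h; linarith
    simp
    rw [div_mul_cancel₀ _ this]; ring
  · obtain ⟨μ, hμ, hz⟩ := wi_ray_dir hb ho w (-EuclideanSpace.single j 1) hw (by simp)
    refine ⟨_, hz, ⟨(c - w j) / (c - (w j - μ)), ⟨div_nonneg (by linarith) (by linarith),
      (div_le_one (by linarith)).2 (by linarith)⟩, ?_⟩, fun i hi => by simp [hi]⟩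
    have : c - (w j - μ) ≠ 0 := by intro h; linarith
    simp
    field_simp
    ring

lemma wi_range {Ω : Set (EuclideanSpace ℝ (Fin 2))} (hb : Bornology.IsBounded Ω) (ho : IsOpen Ω)
    (hc : IsConnected Ω) (j : Fin 2) : ∃ c ρ : ℝ, 0 < ρ ∧ (∀ z ∈ closure Ω, |z j - c| ≤ ρ) ∧
      ∀ t ∈ Set.Ioo (c - ρ) (c + ρ), ∃ z ∈ frontier Ω, ∃ z' ∈ frontier Ω, z ≠ z' ∧ z j = t ∧ z' j = t := by
  have hcl : IsCompact (closure Ω) := hb.isCompact_closure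
  have hne : (closure Ω).Nonempty := hc.nonempty.closure
  have hcont : Continuous (fun z : EuclideanSpace ℝ (Fin 2) => z j) := by fun_prop
  obtain ⟨z1, hz1, hmax⟩ := hcl.exists_isMaxOn hne hcont.continuousOn
  obtain ⟨z0, hz0, hmin⟩ := hcl.exists_isMinOn hne hcont.continuousOn
  have hmax' : ∀ z ∈ closure Ω, z j ≤ z1 j := fun z hz => hmax hz
  have hmin' : ∀ z ∈ closure Ω, z0 j ≤ z j := fun z hz => hmin hz
  have hlt : z0 j < z1 j := by
    obtain ⟨w, hw⟩ := hc.nonempty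
    obtain ⟨μ, hμ, hz⟩ := wi_ray_dir hb ho w (EuclideanSpace.single j 1) hw (by simp)
    have h1 := hmax' _ (frontier_subset_closure hz)
    have h2 := hmin' _ (subset_closure hw)
    simp at h1
    linarith
  refine ⟨(z0 j + z1 j) / 2, (z1 j - z0 j) / 2, by linarith, fun z hz => ?_, fun t ht => ?_⟩
  · have h1 := hmax' z hz
    have h2 := hmin' z hz
    rw [abs_le]; constructor <;> linarith
  · have ht0 : z0 j < t := by linarith [ht.1]
    have ht1 : t < z1 j := by linarith [ht.2]
    obtain ⟨w1, hw1, hw1'⟩ := mem_closure_iff.1 hz1 {z | t < z j} (isOpen_lt continuous_const hcont) ht1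
    obtain ⟨w0, hw0, hw0'⟩ := mem_closure_iff.1 hz0 {z | z j < t} (isOpen_lt hcont continuous_const) ht0
    have hpre := hc.isPreconnected.image _ hcont.continuousOn
    obtain ⟨w, hw, hwt⟩ := hpre.Icc_subset ⟨w0, hw0', rfl⟩ ⟨w1, hw1', rfl⟩ ⟨le_of_lt hw0, le_of_lt hw1⟩
    simp only at hwt
    have hj : j ≠ 1 - j := by fin_cases j <;> simp
    obtain ⟨μ, hμ, hz⟩ := wi_ray_dir hb ho w (EuclideanSpace.single (1 - j) 1) hw (by simp)
    obtain ⟨μ', hμ', hz'⟩ := wi_ray_dir hb ho w (-EuclideanSpace.single (1 - j) 1) hw (by simp)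
    refine ⟨_, hz, _, hz', fun heq => ?_, by simp [hj, hwt], by simp [hj, hwt]⟩
    have := congrArg (fun z : EuclideanSpace ℝ (Fin 2) => z (1 - j)) heq
    simp at this
    linarith

lemma wi_zero {E : Set ℝ} {X Y X' Y' : ℝ → ℝ} {Ω : Set (EuclideanSpace ℝ (Fin 2))}
    (hb : Bornology.IsBounded Ω) (ho : IsOpen Ω) (hc : IsConnected Ω)
    (h : WiPar (frontier Ω) E X Y X' Y') (a : ℝ) (ha : 0 < a)
    (hv : volume Ω = ENNReal.ofReal (π * a))
    (hcost : ∫⁻ s in E, ENNReal.ofReal (√(X' s ^ 2 + Y' s ^ 2)) ≤ ENNReal.ofReal (2 * π * √a)) :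
    ∃ c0 c1 : ℝ, ∀ᵐ s ∂(volume.restrict E), (X s - c0) ^ 2 + (Y s - c1) ^ 2 = a := by
  have hm1 := h.mX; have hm2 := h.mY; have hm3 := h.mX'; have hm4 := h.mY'
  have hKc : IsCompact (frontier Ω) := isCompact_of_isClosed_isBounded isClosed_frontier
    (hb.closure.subset frontier_subset_closure)
  obtain ⟨c0, ρ0, hρ0, hcl0, hd0⟩ := wi_range hb ho hc 0
  obtain ⟨c1, ρ1, hρ1, hcl1, hd1⟩ := wi_range hb ho hc 1
  refine ⟨c0, c1, ?_⟩
  have hcl0' : ∀ s ∈ E, |X s - c0| ≤ ρ0 := fun s hs => by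
    simpa using hcl0 _ (frontier_subset_closure (h.img s hs))
  have hcl1' : ∀ s ∈ E, |Y s - c1| ≤ ρ1 := fun s hs => by
    simpa using hcl1 _ (frontier_subset_closure (h.img s hs))
  have hdd0 := wi_double h hKc (fun z => z 0) (by fun_prop) X X' (fun s => by simp) hm1 hm3 h.dX
    (Set.Ioo (c0 - ρ0) (c0 + ρ0)) hd0 (fun t => ENNReal.ofReal (√(ρ0 ^ 2 - (t - c0) ^ 2))) (by fun_prop)
  have hdd1 := wi_double h hKc (fun z => z 1) (by fun_prop) Y Y' (fun s => by simp) hm2 hm4 h.dY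
    (Set.Ioo (c1 - ρ1) (c1 + ρ1)) hd1 (fun t => ENNReal.ofReal (√(ρ1 ^ 2 - (t - c1) ^ 2))) (by fun_prop)
  have e2 : ∀ ρ : ℝ, 2 * ENNReal.ofReal (π * ρ ^ 2 / 2) = ENNReal.ofReal (π * ρ ^ 2) := fun ρ => by
    rw [show (2 : ENNReal) = ENNReal.ofReal 2 by simp, ← ENNReal.ofReal_mul (by norm_num)]
    congr 1; ring
  rw [wi_halfdisc _ _ hρ0, e2] at hdd0
  rw [wi_halfdisc _ _ hρ1, e2] at hdd1
  have hs0 := wi_schmidt0 h c0 Ω (fun w hw => by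
    obtain ⟨z, hz, ⟨l, hl, hl2⟩, hi⟩ := wi_hit hb ho 0 c0 w hw
    obtain ⟨s, hs, hx, hy⟩ := h.surj z hz
    exact ⟨s, hs, l, hl, by rw [hx]; exact hl2, by rw [hy]; exact hi 1 (by simp)⟩)
  have hs1 := wi_schmidt1 h c1 Ω (fun w hw => by
    obtain ⟨z, hz, ⟨l, hl, hl2⟩, hi⟩ := wi_hit hb ho 1 c1 w hw
    obtain ⟨s, hs, hx, hy⟩ := h.surj z hz
    exact ⟨s, hs, l, hl, by rw [hy]; exact hl2, by rw [hx]; exact hi 0 (by simp)⟩)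
  rw [hv] at hs0 hs1
  obtain ⟨q0, hae0⟩ := wi_zero_core h.measE hm1 hm3 hm4 c0 ρ0 a hρ0 ha hcl0' hdd0 hs0
    (by simpa only [add_comm] using hcost)
  obtain ⟨q1, hae1⟩ := wi_zero_core h.measE hm2 hm4 hm3 c1 ρ1 a hρ1 ha hcl1' hdd1 hs1 hcost
  filter_upwards [hae0, hae1, ae_restrict_mem h.measE] with s i0 i1 hsE
  have hreg := h.reg s hsE
  apply mul_right_cancel₀ hreg.ne'
  rw [q0] at i0
  rw [q1] at i1
  linear_combination i0 + i1

lemma wi_zero_finish {E : Set ℝ} {X Y X' Y' : ℝ → ℝ} {Ω : Set (EuclideanSpace ℝ (Fin 2))}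
    (hb : Bornology.IsBounded Ω) (ho : IsOpen Ω) (hc : IsConnected Ω) (hC2 : HasC2Boundary Ω)
    (h : WiPar (frontier Ω) E X Y X' Y') (a : ℝ) (ha : 0 < a) (c0 c1 : ℝ)
    (hae : ∀ᵐ s ∂(volume.restrict E), (X s - c0) ^ 2 + (Y s - c1) ^ 2 = a) :
    ∃ c r, Ω = ball c r := by
  have hm1 := h.mX; have hm2 := h.mY; have hm3 := h.mX'; have hm4 := h.mY'
  obtain ⟨n, γ, hγ, hper, hd, hK⟩ := hC2
  set S := E ∩ {s | (X s - c0) ^ 2 + (Y s - c1) ^ 2 ≠ a} with hS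
  have hSm : MeasurableSet S := h.measE.inter
    ((measurableSet_eq_fun (f := fun s => (X s - c0) ^ 2 + (Y s - c1) ^ 2) (g := fun _ => a)
      (by fun_prop) (by fun_prop)).compl)
  have hS0 : volume S = 0 := by
    rw [ae_restrict_iff' h.measE] at hae
    refine measure_mono_null ?_ (ae_iff.1 hae)
    intro s hs
    exact fun hcon => hs.2 (hcon hs.1)
  have hX0 : volume (X '' S) = 0 := by
    refine le_antisymm ((wi_line_image S hSm X X' fun s hs =>
      (h.dX s hs.1).mono Set.inter_subset_left).trans (le_of_eq ?_)) zero_le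
    rw [Measure.restrict_eq_zero.2 hS0, lintegral_zero_measure]
  have hY0 : volume (Y '' S) = 0 := by
    refine le_antisymm ((wi_line_image S hSm Y Y' fun s hs =>
      (h.dY s hs.1).mono Set.inter_subset_left).trans (le_of_eq ?_)) zero_le
    rw [Measure.restrict_eq_zero.2 hS0, lintegral_zero_measure]
  have hnull : ∀ j : Fin 2, volume ((fun z : EuclideanSpace ℝ (Fin 2) => z j) ''
      (frontier Ω ∩ {z | (z 0 - c0) ^ 2 + (z 1 - c1) ^ 2 ≠ a})) = 0 := fun j => by
    fin_cases j
    · refine measure_mono_null ?_ hX0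
      rintro _ ⟨z, ⟨hz, hz2⟩, rfl⟩
      obtain ⟨s, hs, hx, hy⟩ := h.surj z hz
      exact ⟨s, ⟨hs, fun hcon => hz2 (by rw [← hx, ← hy]; exact hcon)⟩, hx⟩
    · refine measure_mono_null ?_ hY0
      rintro _ ⟨z, ⟨hz, hz2⟩, rfl⟩
      obtain ⟨s, hs, hx, hy⟩ := h.surj z hz
      exact ⟨s, ⟨hs, fun hcon => hz2 (by rw [← hx, ← hy]; exact hcon)⟩, hy⟩
  have hall : ∀ z ∈ frontier Ω, (z 0 - c0) ^ 2 + (z 1 - c1) ^ 2 = a := by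
    intro z hz
    by_contra hne
    have hz' := hz
    rw [hK] at hz'
    obtain ⟨i, t, rfl⟩ := Set.mem_iUnion.1 hz'
    have hcont : Continuous (γ i) := (hγ i).continuous
    have hdiff : Differentiable ℝ (γ i) := (hγ i).differentiable (by norm_num)
    obtain ⟨j, hj⟩ : ∃ j, deriv (γ i) t j ≠ 0 := by
      by_contra hcon
      push Not at hcon
      exact hd i t (wi_ext (by simpa using hcon 0) (by simpa using hcon 1))
    have hop : IsOpen {s | (γ i s 0 - c0) ^ 2 + (γ i s 1 - c1) ^ 2 ≠ a} :=
      isOpen_ne_fun (by fun_prop) continuous_const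
    obtain ⟨ε, hε, hball⟩ := Metric.isOpen_iff.1 hop t hne
    have hpre : IsPreconnected ((fun s => γ i s j) '' ball t ε) :=
      (convex_ball t ε).isPreconnected.image _ (by fun_prop)
    have hv0 : volume ((fun s => γ i s j) '' ball t ε) = 0 := by
      refine measure_mono_null ?_ (hnull j)
      rintro _ ⟨s, hs, rfl⟩
      exact ⟨γ i s, ⟨by rw [hK]; exact Set.mem_iUnion.2 ⟨i, s, rfl⟩, hball hs⟩, rfl⟩
    have key : ∀ s ∈ ball t ε, ∀ s' ∈ ball t ε, ¬ γ i s j < γ i s' j := fun s hs s' hs' hlt => by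
      have := measure_mono (μ := volume) (hpre.Icc_subset ⟨s, hs, rfl⟩ ⟨s', hs', rfl⟩)
      rw [hv0, Real.volume_Icc] at this
      have := ENNReal.ofReal_eq_zero.1 (le_antisymm this zero_le)
      simp only at this
      linarith
    have ht : t ∈ ball t ε := mem_ball_self hε
    have hconst : (fun s => γ i s j) =ᶠ[nhds t] fun _ => γ i t j := by
      filter_upwards [isOpen_ball.mem_nhds ht] with s hs
      exact le_antisymm (not_lt.1 (key t ht s hs)) (not_lt.1 (key s hs t ht))
    have hD : HasDerivAt (fun t => γ i t j) (deriv (γ i) t j) t :=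
      (EuclideanSpace.proj (𝕜 := ℝ) j).hasFDerivAt.comp_hasDerivAt t (hdiff t).hasDerivAt
    exact hj (hD.unique ((hasDerivAt_const t (γ i t j)).congr_of_eventuallyEq hconst))
  refine ⟨!₂[c0, c1], √a, wi_ball_general ho hb hc.nonempty _ _ (Real.sqrt_pos.2 ha) fun z hz => ?_⟩
  rw [mem_sphere, dist_eq_norm, wi_norm]
  congr 1
  have := hall z hz
  simpa using this

/-- Theorem 2.1 (iii): if `p ≥ -1`, `Ω` is a bounded open connected set with `C²`
boundary containing the origin, and equality holds in the weighted isoperimetric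
inequality, then `Ω` is a disc; if moreover `p ≠ 0`, the disc is centered at `0`. -/
theorem weighted_isoperimetric_equality_connected
    (p : ℝ) (hp : -1 ≤ p)
    (Ω : Set (EuclideanSpace ℝ (Fin 2)))
    (hopen : IsOpen Ω) (hbdd : Bornology.IsBounded Ω)
    (hconn : IsConnected Ω)
    (hbry : HasC2Boundary Ω)
    (h0 : (0 : EuclideanSpace ℝ (Fin 2)) ∈ Ω)
    (heq : ((volume Ω).toReal / π) ^ ((p + 1) / 2) =
      (1 / (2 * π)) * ∫ x in frontier Ω, ‖x‖ ^ p ∂μH[1]) :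
    ∃ (c : EuclideanSpace ℝ (Fin 2)) (rad : ℝ),
      Ω = ball c rad ∧ (p ≠ 0 → c = 0) := by
  have hpi := pi_pos
  have hbry' := hbry
  obtain ⟨n, γ, hγ1, hγ2, hγ3, hK⟩ := hbry'
  obtain ⟨M, c, hc1, hc2, hc3, hcK⟩ := wi_pieces n γ hγ1 hγ2 hγ3
  obtain ⟨E, X, Y, X', Y', h⟩ := wi_par_exists (frontier Ω) M c hc1 hc2 hc3 (hK.trans hcK)
  have hvfin : volume Ω ≠ ⊤ := hbdd.measure_lt_top.ne
  have hvpos : 0 < (volume Ω).toReal :=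
    ENNReal.toReal_pos (hopen.measure_pos volume ⟨0, h0⟩).ne' hvfin
  have hcost := wi_cost hopen h0 p h hvpos heq
  set a := (volume Ω).toReal / π with hadef
  have ha : 0 < a := by positivity
  have hv : volume Ω = ENNReal.ofReal (π * a) := by
    rw [hadef, mul_div_cancel₀ _ hpi.ne', ENNReal.ofReal_toReal hvfin]
  have hq := wi_qpos hopen h0 h
  have hcentered : ENNReal.ofReal (2 * π * a ^ ((p + 1) / 2)) ≤
      ∫⁻ s in E, ENNReal.ofReal ((X s ^ 2 + Y s ^ 2) ^ ((p + 1) / 2 - 1) *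
      |X s * Y' s - Y s * X' s|) → ∃ (c : EuclideanSpace ℝ (Fin 2)) (rad : ℝ),
      Ω = ball c rad ∧ (p ≠ 0 → c = 0) := fun hl => by
    obtain ⟨r, hr⟩ := wi_finish hopen hbdd hconn h0 hbry h (wi_lemA _ _ h hq hcost hl)
    exact ⟨0, r, hr, fun _ => rfl⟩
  rcases hp.eq_or_lt with hp1 | hp1
  · apply hcentered
    have e1 : (p + 1) / 2 = 0 := by rw [← hp1]; norm_num
    rw [e1, Real.rpow_zero, mul_one]
    exact wi_case0 hbdd hopen h0 h
  rcases le_or_gt 1 p with hp2 | hp2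
  · exact hcentered (wi_case1 hbdd hopen h0 h _ a (by linarith) ha hv)
  by_cases hp0 : p = 0
  · subst hp0
    have hcost' : ∫⁻ s in E, ENNReal.ofReal (√(X' s ^ 2 + Y' s ^ 2)) ≤ ENNReal.ofReal (2 * π * √a) := by
      rw [Real.sqrt_eq_rpow]
      norm_num at hcost ⊢
      refine le_trans (le_of_eq ?_) hcost
      refine setLIntegral_congr_fun h.measE fun s hs => ?_
      have hqs := hq s hs
      have e1 : (X s * Y' s - Y s * X' s) ^ 2 + (X s * X' s + Y s * Y' s) ^ 2
        = (X s ^ 2 + Y s ^ 2) * (X' s ^ 2 + Y' s ^ 2) := by ring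
      have e2 : (X s ^ 2 + Y s ^ 2) ^ (-(1 / 2) : ℝ) * √(X s ^ 2 + Y s ^ 2) = 1 := by
        rw [Real.sqrt_eq_rpow, ← Real.rpow_add hqs]; norm_num
      simp only [e1]
      rw [Real.sqrt_mul hqs.le, ← mul_assoc, e2, one_mul]
    obtain ⟨c0, c1, hae⟩ := wi_zero hbdd hopen hconn h a ha hv hcost'
    obtain ⟨c, r, hcr⟩ := wi_zero_finish hbdd hopen hconn hbry h a ha c0 c1 hae
    exact ⟨c, r, hcr, fun hne => absurd rfl hne⟩
  · apply hcentered
    exact wi_mid hbdd hopen hconn h0 h _ a (by linarith) (by linarith)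
      (fun hh => hp0 (by linarith)) ha hv hcost
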